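/- Let A be a complex affine Poisson algebra (a finitely generated integral domain ℂ-algebra with a Poisson bracket) of Krull dimension at most 3. Then the Poisson Dixmier-Moeglin equivalence holds for A: for every Poisson prime ideal P of A, P is Poisson locally closed if and only if P is Poisson primitive if and only if P is Poisson rational. -/

import Mathlib

/-- A Poisson bracket on a commutative `k`-algebra `A`: a `k`-bilinear map which is
antisymmetric, satisfies the Jacobi identity, and the Leibniz rule. -/
structure PoissonBracket (k A : Type*) [CommRing k] [CommRing A] [Algebra k A] where
  br : A →ₗ[k] A →ₗ[k] A
  antisymm : ∀ a b : A, br a b = - br b a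
  jacobi : ∀ a b c : A, br a (br b c) + br c (br a b) + br b (br c a) = 0
  leibniz : ∀ a b c : A, br (a * b) c = a * br b c + b * br a c

/-- An ideal `I` is a Poisson ideal if `{I, A} ⊆ I`. -/
def PoissonBracket.IsPoissonIdeal {k A : Type*} [CommRing k] [CommRing A] [Algebra k A]
    (pb : PoissonBracket k A) (I : Ideal A) : Prop :=
  ∀ a ∈ I, ∀ b : A, pb.br a b ∈ I

/-- `P` is the Poisson core of `J`: the largest Poisson ideal contained in `J`. -/
def PoissonBracket.IsPoissonCore {k A : Type*} [CommRing k] [CommRing A] [Algebra k A]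
    (pb : PoissonBracket k A) (P J : Ideal A) : Prop :=
  pb.IsPoissonIdeal P ∧ P ≤ J ∧ ∀ I : Ideal A, pb.IsPoissonIdeal I → I ≤ J → I ≤ P

/-- `P` is Poisson primitive if it is the Poisson core of some maximal ideal. -/
def PoissonBracket.IsPoissonPrimitive {k A : Type*} [CommRing k] [CommRing A] [Algebra k A]
    (pb : PoissonBracket k A) (P : Ideal A) : Prop :=
  ∃ J : Ideal A, J.IsMaximal ∧ pb.IsPoissonCore P J

/-- `P` is Poisson locally closed if the intersection of all Poisson prime ideals strictly
containing `P` is strictly larger than `P`. -/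
def PoissonBracket.IsPoissonLocallyClosed {k A : Type*} [CommRing k] [CommRing A] [Algebra k A]
    (pb : PoissonBracket k A) (P : Ideal A) : Prop :=
  P < sInf {Q : Ideal A | Q.IsPrime ∧ pb.IsPoissonIdeal Q ∧ P < Q}

/-- `P` is Poisson rational: every element of the Poisson center of the fraction field of
`A ⧸ P` (with the unique extension of the Poisson bracket, captured by quantifying over
all compatible Poisson brackets on `Frac(A ⧸ P)`) is algebraic over `k`. -/
def PoissonBracket.IsPoissonRational {k A : Type*} [Field k] [CommRing A] [Algebra k A]
    (pb : PoissonBracket k A) (P : Ideal A) : Prop :=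
  ∀ pbF : PoissonBracket k (FractionRing (A ⧸ P)),
    (∀ a b : A,
      pbF.br (algebraMap (A ⧸ P) (FractionRing (A ⧸ P)) (Ideal.Quotient.mk P a))
          (algebraMap (A ⧸ P) (FractionRing (A ⧸ P)) (Ideal.Quotient.mk P b)) =
        algebraMap (A ⧸ P) (FractionRing (A ⧸ P)) (Ideal.Quotient.mk P (pb.br a b))) →
    ∀ f : FractionRing (A ⧸ P), (∀ g, pbF.br f g = 0) → IsAlgebraic k f

/-- extension of a derivation to the fraction field -/
theorem der_ext_frac {k C F N : Type*} [CommRing k] [CommRing C] [IsDomain C] [Algebra k C] [Field F]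
    [Algebra C F] [Algebra k F] [IsScalarTower k C F] [IsFractionRing C F]
    [AddCommGroup N] [Module F N] [Module C N] [Module k N] [IsScalarTower C F N]
    [IsScalarTower k F N] [IsScalarTower k C N] (d : Derivation k C N) :
    ∃ D : Derivation k F N, ∀ c, D (algebraMap C F c) = d c := by
  let g := d.liftKaehlerDifferential
  have hu : ∀ x : nonZeroDivisors C, IsUnit ((algebraMap C (Module.End C N)) x) := by
    intro x
    have hx : algebraMap C F x ≠ 0 := IsLocalization.to_map_ne_zero_of_mem_nonZeroDivisors F le_rfl x.2
    rw [Module.End.isUnit_iff]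
    constructor
    · intro a b hab
      simp only [Module.algebraMap_end_apply] at hab
      rw [← IsScalarTower.algebraMap_smul F, ← IsScalarTower.algebraMap_smul F (x:C) b] at hab
      exact smul_right_injective N hx hab
    · intro b
      refine ⟨(algebraMap C F x)⁻¹ • b, ?_⟩
      simp only [Module.algebraMap_end_apply]
      rw [← IsScalarTower.algebraMap_smul F, smul_inv_smul₀ hx]
  let h : Ω[F⁄k] →ₗ[C] N := IsLocalizedModule.lift (nonZeroDivisors C) (KaehlerDifferential.map k k C F) g hu
  let h' : Ω[F⁄k] →ₗ[F] N := h.extendScalarsOfIsLocalization (nonZeroDivisors C) F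
  refine ⟨h'.compDer (KaehlerDifferential.D k F), fun c => ?_⟩
  have h1 : KaehlerDifferential.D k F (algebraMap C F c) = KaehlerDifferential.map k k C F (KaehlerDifferential.D k C c) := by
    simp
  have h2 : h (KaehlerDifferential.map k k C F (KaehlerDifferential.D k C c)) = g (KaehlerDifferential.D k C c) :=
    IsLocalizedModule.lift_apply _ _ _ _ _
  have h3 : g (KaehlerDifferential.D k C c) = d c := d.liftKaehlerDifferential_comp_D c
  change h (KaehlerDifferential.D k F (algebraMap C F c)) = d c
  rw [h1, h2, h3]

theorem der_frac_zero {k C F N : Type*} [CommRing k] [CommRing C] [IsDomain C] [Algebra k C] [Field F]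
    [Algebra C F] [Algebra k F] [IsScalarTower k C F] [IsFractionRing C F]
    [AddCommGroup N] [Module F N] [Module k N] [IsScalarTower k F N]
    (D : Derivation k F N) (h : ∀ c, D (algebraMap C F c) = 0) : D = 0 := by
  ext f
  obtain ⟨a, b, hb, rfl⟩ := IsFractionRing.div_surjective (A := C) f
  have hb' : algebraMap C F b ≠ 0 := IsLocalization.to_map_ne_zero_of_mem_nonZeroDivisors F le_rfl hb
  have h1 := h a
  have : algebraMap C F a = (algebraMap C F a / algebraMap C F b) * algebraMap C F b := by
    field_simp
  rw [this, D.leibniz, h b, smul_zero, zero_add] at h1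
  exact (smul_eq_zero.1 h1).resolve_left hb'

theorem der_frac_ext {k C F N : Type*} [CommRing k] [CommRing C] [IsDomain C] [Algebra k C] [Field F]
    [Algebra C F] [Algebra k F] [IsScalarTower k C F] [IsFractionRing C F]
    [AddCommGroup N] [Module F N] [Module k N] [IsScalarTower k F N]
    (D E : Derivation k F N) (h : ∀ c, D (algebraMap C F c) = E (algebraMap C F c)) : D = E := by
  rw [← sub_eq_zero]
  apply der_frac_zero (C := C)
  intro c
  simp [h c]

theorem der_zero_of_algebraic {k R S N : Type*} [CommRing k] [CommRing R] [CommRing S] [IsDomain R]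
    [CharZero R] [Algebra k S] [Algebra R S] [FaithfulSMul R S]
    [AddCommGroup N] [Module S N] [Module k N] [IsDomain S] [Module.IsTorsionFree S N]
    (d : Derivation k S N) (h : ∀ r, d (algebraMap R S r) = 0) (s : S) (hs : IsAlgebraic R s) :
    d s = 0 := by
  classical
  have key : ∀ p : Polynomial R, d (Polynomial.aeval s p) = Polynomial.aeval s p.derivative • d s := by
    intro p
    induction p using Polynomial.induction_on' with
    | add p q hp hq => simp [hp, hq, add_smul]
    | monomial n a =>
      rw [Polynomial.aeval_monomial, d.leibniz, h, smul_zero, add_zero, d.leibniz_pow,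
        Polynomial.derivative_monomial, Polynomial.aeval_monomial]
      simp [mul_smul, mul_assoc, Nat.cast_smul_eq_nsmul]
  obtain ⟨p0, hp0, hp0'⟩ := hs
  let Q : ℕ → Prop := fun n => ∃ p : Polynomial R, p ≠ 0 ∧ Polynomial.aeval s p = 0 ∧ p.natDegree = n
  have hQ : ∃ n, Q n := ⟨_, p0, hp0, hp0', rfl⟩
  obtain ⟨p, hp, hps, hpn⟩ := Nat.find_spec hQ
  have hn0 : p.natDegree ≠ 0 := by
    intro h0
    rw [Polynomial.eq_C_of_natDegree_eq_zero h0] at hps hp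
    rw [Polynomial.aeval_C] at hps
    apply hp
    rw [(FaithfulSMul.algebraMap_injective R S) (hps.trans (map_zero _).symm), map_zero]
  have hd : Polynomial.aeval s p.derivative ≠ 0 := by
    intro h0
    have := Nat.find_min hQ (m := p.derivative.natDegree) (by
      rw [← hpn]; exact Polynomial.natDegree_derivative_lt hn0)
    apply this
    refine ⟨_, ?_, h0, rfl⟩
    intro h1
    exact hn0 (Polynomial.derivative_eq_zero.1 h1)
  have := key p
  rw [hps, map_zero] at this
  exact (smul_eq_zero.1 this.symm).resolve_left hd

/-- the Hamiltonian derivation `{a, -}` -/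
def PoissonBracket.ham {k A : Type*} [CommRing k] [CommRing A] [Algebra k A]
    (pb : PoissonBracket k A) (a : A) : Derivation k A A :=
  Derivation.mk' (pb.br a) (by
    intro b c
    rw [pb.antisymm a (b * c), pb.leibniz, pb.antisymm a b, pb.antisymm a c]
    simp only [smul_eq_mul]; ring)

theorem PoissonBracket.ham_apply {k A : Type*} [CommRing k] [CommRing A] [Algebra k A]
    (pb : PoissonBracket k A) (a b : A) : pb.ham a b = pb.br a b := rfl

theorem poisson_ext_frac {k B F : Type*} [Field k] [CommRing B] [IsDomain B] [Algebra k B]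
    [Field F] [Algebra B F] [Algebra k F] [IsScalarTower k B F] [IsFractionRing B F]
    (pb : PoissonBracket k B) :
    ∃ pbF : PoissonBracket k F, ∀ a b, pbF.br (algebraMap B F a) (algebraMap B F b) =
      algebraMap B F (pb.br a b) := by
  have h1 : ∀ b : B, ∃ D : Derivation k F F, ∀ a, D (algebraMap B F a) = algebraMap B F (pb.br b a) := by
    intro b
    obtain ⟨D, hD⟩ := der_ext_frac (F := F) (N := F) ((Algebra.linearMap B F).compDer (pb.ham b))
    exact ⟨D, fun a => by rw [hD]; rfl⟩
  choose E hE using h1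
  let E' : Derivation k B (Derivation k F F) := Derivation.mk'
    { toFun := E
      map_add' := by
        intro a b
        apply der_frac_ext (C := B)
        intro c
        simp [hE]
      map_smul' := by
        intro r a
        apply der_frac_ext (C := B)
        intro c
        rw [hE, map_smul, LinearMap.smul_apply, RingHom.id_apply, Derivation.smul_apply, hE]
        exact (Algebra.linearMap B F).map_smul_of_tower r _ } (by
      intro a b
      apply der_frac_ext (C := B)
      intro c
      change E (a * b) _ = (a • E b + b • E a) _
      rw [Derivation.add_apply, Derivation.smul_apply, Derivation.smul_apply, hE, hE, hE, pb.leibniz]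
      simp [Algebra.smul_def])
  have hE' : ∀ b, E' b = E b := fun b => rfl
  obtain ⟨T, hT⟩ := der_ext_frac (F := F) E'
  have hTT : ∀ a b, T (algebraMap B F a) (algebraMap B F b) = algebraMap B F (pb.br a b) := by
    intro a b; rw [hT, hE', hE]
  let ev : F → Derivation k F F := fun c => Derivation.mk'
    { toFun := fun f => T f c
      map_add' := by intro a b; simp
      map_smul' := by intro a b; simp } (by intro a b; simp)
  have hev : ∀ c f, ev c f = T f c := fun c f => rfl
  have anti1 : ∀ b f, T (algebraMap B F b) f = - T f (algebraMap B F b) := by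
    intro b f
    have : T (algebraMap B F b) = - ev (algebraMap B F b) := by
      apply der_frac_ext (C := B)
      intro c
      rw [Derivation.neg_apply, hev, hTT, hTT, pb.antisymm, map_neg]
    rw [this, Derivation.neg_apply, hev]
  have anti : ∀ g f, T g f = - T f g := by
    intro g f
    have : T g = - ev g := by
      apply der_frac_ext (C := B)
      intro c
      rw [Derivation.neg_apply, hev, anti1, neg_neg]
    rw [this, Derivation.neg_apply, hev]
  have jac0 : ∀ a b : F, (∀ c : B, T a (T b (algebraMap B F c)) + T (algebraMap B F c) (T a b) + T b (T (algebraMap B F c) a) = 0) →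
      ∀ c : F, T a (T b c) + T c (T a b) + T b (T c a) = 0 := by
    intro a b h c
    have hf : ∀ c, T a (T b c) + T c (T a b) + T b (T c a) = (⁅T a, T b⁆ - T (T a b)) c := by
      intro c
      rw [Derivation.sub_apply, Derivation.commutator_apply, anti c (T a b), anti c a, map_neg]
      ring
    have : ⁅T a, T b⁆ - T (T a b) = 0 := by
      apply der_frac_zero (C := B)
      intro c
      rw [← hf]; exact h c
    rw [hf, this, Derivation.zero_apply]
  have cyc : ∀ a b c : F, T a (T b c) + T c (T a b) + T b (T c a) = 0 → T c (T a b) + T b (T c a) + T a (T b c) = 0 := by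
    intro a b c h; rw [← h]; ring
  have jac1 : ∀ (a b : B) (c : F), T (algebraMap B F a) (T (algebraMap B F b) c) + T c (T (algebraMap B F a) (algebraMap B F b)) + T (algebraMap B F b) (T c (algebraMap B F a)) = 0 := by
    intro a b
    apply jac0
    intro c
    simp only [hTT, ← map_add]
    rw [pb.jacobi, map_zero]
  have jac2 : ∀ (a : B) (c b : F), T c (T (algebraMap B F a) b) + T b (T c (algebraMap B F a)) + T (algebraMap B F a) (T b c) = 0 := by
    intro a c
    apply jac0
    intro b
    exact cyc _ _ _ (jac1 a b c)
  have jac : ∀ a b c : F, T a (T b c) + T c (T a b) + T b (T c a) = 0 := by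
    intro a b
    apply jac0
    intro c
    rw [← jac2 c b a]; ring
  refine ⟨⟨LinearMap.mk₂ k (fun a b => T a b) ?_ ?_ ?_ ?_, ?_, ?_, ?_⟩, ?_⟩
  · intro a b c; simp
  · intro a b c; simp
  · intro a b c; simp
  · intro a b c; simp
  · intro a b; exact anti a b
  · intro a b c; exact jac a b c
  · intro a b c; simp
  · intro a b; exact hTT a b

theorem minprime_stable {A : Type*} [CommRing A] [Algebra ℂ A] (d : Derivation ℂ A A)
    (I Q : Ideal A) (hI : ∀ a ∈ I, d a ∈ I) (hQ : Q ∈ I.minimalPrimes) : ∀ a ∈ Q, d a ∈ Q := by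
  intro a ha
  have hQp : Q.IsPrime := hQ.1.1
  have hIQ : I ≤ Q := hQ.1.2
  have step : ∀ m k : ℕ, ∀ s, s ∉ Q → s * a ^ m * (d a) ^ k ∈ I → d a ∈ Q := by
    intro m
    induction m with
    | zero =>
      intro k s hs h
      have := hIQ h
      rw [pow_zero, mul_one] at this
      exact hQp.mem_of_pow_mem _ ((hQp.mem_or_mem this).resolve_left hs)
    | succ m ih =>
      intro k s hs h
      apply ih (k + 2) (s ^ 2) (fun h' => hs (hQp.mem_of_pow_mem _ h'))
      have h1 := hI _ h
      have h2 : (s * d a) * d (s * a ^ (m + 1) * d a ^ k) =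
          (d s * d a + s * k * d (d a)) * (s * a ^ (m + 1) * d a ^ k) +
          ((m : A) + 1) * (s ^ 2 * a ^ m * d a ^ (k + 2)) := by
        rcases k with _ | k
        · simp only [Derivation.leibniz, Derivation.leibniz_pow, smul_eq_mul, nsmul_eq_mul]
          push_cast
          simp
          ring
        · simp only [Derivation.leibniz, Derivation.leibniz_pow, smul_eq_mul, nsmul_eq_mul]
          push_cast
          ring
      have h3 : ((m : A) + 1) * (s ^ 2 * a ^ m * d a ^ (k + 2)) ∈ I := by
        have : ((m : A) + 1) * (s ^ 2 * a ^ m * d a ^ (k + 2)) =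
          (s * d a) * d (s * a ^ (m + 1) * d a ^ k) -
          (d s * d a + s * k * d (d a)) * (s * a ^ (m + 1) * d a ^ k) := by rw [h2]; ring
        rw [this]
        exact I.sub_mem (I.mul_mem_left _ h1) (I.mul_mem_left _ h)
      have h4 : s ^ 2 * a ^ m * d a ^ (k + 2) = algebraMap ℂ A (((m : ℂ) + 1)⁻¹) *
          (((m : A) + 1) * (s ^ 2 * a ^ m * d a ^ (k + 2))) := by
        have : ((m : A) + 1) = algebraMap ℂ A ((m : ℂ) + 1) := by simp
        rw [this, ← mul_assoc, ← map_mul, inv_mul_cancel₀ (Nat.cast_add_one_ne_zero m), map_one, one_mul]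
      rw [h4]
      exact I.mul_mem_left _ h3
  by_contra hcon
  have hdis : Disjoint (I : Set A) ((Q.primeCompl ⊔ Submonoid.powers a : Submonoid A) : Set A) := by
    rw [Set.disjoint_left]
    intro x hx hx'
    obtain ⟨s, hs, t, ht, rfl⟩ := Submonoid.mem_sup.1 hx'
    obtain ⟨n, rfl⟩ := ht
    exact hcon (step n 0 s hs (by simpa using hx))
  obtain ⟨p, hp, hIp, hpd⟩ := Ideal.exists_le_prime_disjoint _ _ hdis
  have hpQ : p ≤ Q := by
    intro x hx
    by_contra hxQ
    exact Set.disjoint_left.1 hpd hx (Submonoid.mem_sup_left (show x ∈ Q.primeCompl from hxQ))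
  have := hQ.2 ⟨hp, hIp⟩ hpQ ha
  exact Set.disjoint_left.1 hpd this (Submonoid.mem_sup_right (Submonoid.mem_powers a))

theorem PoissonBracket.core_exists {A : Type*} [CommRing A] [Algebra ℂ A] 
    (pb : PoissonBracket ℂ A) (m : Ideal A) (hm : m.IsMaximal) :
    ∃ Q : Ideal A, Q.IsPrime ∧ pb.IsPoissonCore Q m := by
  let C : Ideal A := sSup {I | pb.IsPoissonIdeal I ∧ I ≤ m}
  have hC : pb.IsPoissonIdeal C := by
    intro a ha b
    have ha' : a ∈ ⨆ I : {I | pb.IsPoissonIdeal I ∧ I ≤ m}, (I : Ideal A) := by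
      rw [← sSup_eq_iSup']; exact ha
    refine Submodule.iSup_induction _ (motive := fun x => pb.br x b ∈ C) ha' ?_ ?_ ?_
    · intro I x hx; exact (le_sSup I.2 : (I : Ideal A) ≤ C) (I.2.1 x hx b)
    · simp
    · intro x y hx hy
      rw [map_add, LinearMap.add_apply]; exact C.add_mem hx hy
  have hCm : C ≤ m := sSup_le fun I hI => hI.2
  have hmp := hm.isPrime
  obtain ⟨Q, hQ, hQm⟩ := Ideal.exists_minimalPrimes_le hCm
  have hQP : pb.IsPoissonIdeal Q := by
    intro a ha b
    rw [pb.antisymm]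
    apply Q.neg_mem
    exact minprime_stable (pb.ham b) C Q (fun x hx => by
      rw [PoissonBracket.ham_apply, pb.antisymm]; exact C.neg_mem (hC x hx b)) hQ a ha
  exact ⟨Q, hQ.1.1, hQP, hQm, fun I h1 h2 => (le_sSup ⟨h1, h2⟩ : I ≤ C).trans hQ.1.2⟩

theorem PoissonBracket.prim_of_lc {A : Type*} [CommRing A] [Algebra ℂ A] (hfg : Algebra.FiniteType ℂ A)
    (pb : PoissonBracket ℂ A) (P : Ideal A) (hP : P.IsPrime) (hPP : pb.IsPoissonIdeal P)
    (h : pb.IsPoissonLocallyClosed P) : pb.IsPoissonPrimitive P := by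
  have hJ : IsJacobsonRing A := isJacobsonRing_of_finiteType (A := ℂ)
  by_contra hcon
  have hle : sInf {Q : Ideal A | Q.IsPrime ∧ pb.IsPoissonIdeal Q ∧ P < Q} ≤ P := by
    intro x hx
    rw [← (isJacobsonRing_iff_prime_eq.1 hJ P hP), Ideal.jacobson, Ideal.mem_sInf]
    rintro m ⟨hPm, hm⟩
    obtain ⟨Q, hQ, hQm⟩ := pb.core_exists m hm
    apply hQm.2.1
    have hPQ : P ≤ Q := hQm.2.2 P hPP hPm
    refine (Ideal.mem_sInf.1 hx) ⟨hQ, hQm.1, lt_of_le_of_ne hPQ ?_⟩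
    rintro rfl
    exact hcon ⟨m, hm, hQm⟩
  exact absurd h hle.not_gt

theorem nullst_mem {A : Type*} [CommRing A] [Algebra ℂ A] (hfg : Algebra.FiniteType ℂ A) (m : Ideal A)
    (hm : m.IsMaximal) (c d : A) (hc : c ∉ m) : ∃ l : ℂ, d - algebraMap ℂ A l * c ∈ m := by
  let _ : Field (A ⧸ m) := Ideal.Quotient.field m
  have : Module.Finite ℂ (A ⧸ m) := finite_of_finite_type_of_isJacobsonRing ℂ (A ⧸ m)
  have hs : Function.Surjective (algebraMap ℂ (A ⧸ m)) :=
    (IsAlgClosed.algebraMap_bijective_of_isIntegral (k := ℂ)).2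
  obtain ⟨l, hl⟩ := hs (Ideal.Quotient.mk m d / Ideal.Quotient.mk m c)
  refine ⟨l, ?_⟩
  have hc' : Ideal.Quotient.mk m c ≠ 0 := fun h => hc (Ideal.Quotient.eq_zero_iff_mem.1 h)
  rw [← Ideal.Quotient.eq_zero_iff_mem, map_sub, map_mul]
  change _ - algebraMap ℂ (A ⧸ m) l * _ = 0
  rw [hl, div_mul_cancel₀ _ hc', sub_self]

theorem PoissonBracket.br_mul_left_aux {k A : Type*} [CommRing k] [CommRing A] [Algebra k A]
    (pb : PoissonBracket k A) (a z b : A) (hz : ∀ g, pb.br z g = 0) : pb.br (a * z) b = pb.br a b * z := by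
  rw [pb.leibniz, hz, mul_zero, zero_add, mul_comm]

theorem PoissonBracket.rat_of_prim {A : Type*} [CommRing A] [Algebra ℂ A] (hfg : Algebra.FiniteType ℂ A)
    (pb : PoissonBracket ℂ A) (P : Ideal A) (hP : P.IsPrime) 
    (h : pb.IsPoissonPrimitive P) : pb.IsPoissonRational P := by
  obtain ⟨m, hm, hPP, hPm, hcore⟩ := h
  intro pbF hpbF z hz
  let ρ : A →ₐ[ℂ] FractionRing (A ⧸ P) := (IsScalarTower.toAlgHom ℂ (A ⧸ P) (FractionRing (A ⧸ P))).comp (Ideal.Quotient.mkₐ ℂ P)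
  have hρ : ∀ a b, pbF.br (ρ a) (ρ b) = ρ (pb.br a b) := hpbF
  have hρ0 : ∀ a, ρ a = 0 ↔ a ∈ P := by
    intro a
    change algebraMap (A ⧸ P) (FractionRing (A ⧸ P)) (Ideal.Quotient.mk P a) = 0 ↔ _
    rw [map_eq_zero_iff _ (IsFractionRing.injective (A ⧸ P) _), Ideal.Quotient.eq_zero_iff_mem]
  by_contra hcon
  let I : Ideal A :=
    { carrier := {c | ∃ d, ρ c * z = ρ d}
      add_mem' := by
        rintro a b ⟨d, hd⟩ ⟨e, he⟩
        exact ⟨d + e, by rw [map_add, add_mul, hd, he, map_add]⟩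
      zero_mem' := ⟨0, by simp⟩
      smul_mem' := by
        rintro c x ⟨d, hd⟩
        exact ⟨c * d, by rw [smul_eq_mul, map_mul, mul_assoc, hd, map_mul]⟩ }
  have hI : ∀ c, c ∈ I ↔ ∃ d, ρ c * z = ρ d := fun c => Iff.rfl
  have hIP : pb.IsPoissonIdeal I := by
    rintro c ⟨d, hd⟩ b
    refine ⟨pb.br d b, ?_⟩
    rw [← hρ, ← hρ, ← hd, pbF.br_mul_left_aux _ _ _ hz]
  have hIm : ¬ I ≤ m := by
    intro hle
    have h1 := hcore I hIP hle
    obtain ⟨a, b, hb, rfl⟩ := IsFractionRing.div_surjective (A := A ⧸ P) z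
    obtain ⟨a, rfl⟩ := Ideal.Quotient.mk_surjective a
    obtain ⟨b, rfl⟩ := Ideal.Quotient.mk_surjective b
    have hb0 : ρ b ≠ 0 := IsLocalization.to_map_ne_zero_of_mem_nonZeroDivisors (R := A ⧸ P) (FractionRing (A ⧸ P)) le_rfl hb
    have : b ∈ I := ⟨a, by change ρ b * (ρ a / ρ b) = _; field_simp⟩
    exact hb0 ((hρ0 b).2 (h1 this))
  obtain ⟨c0, ⟨d0, hd0⟩, hc0m⟩ := SetLike.not_le_iff_exists.1 hIm
  obtain ⟨l, hl⟩ := nullst_mem hfg m hm c0 d0 hc0m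
  let z' := z - algebraMap ℂ _ l
  have hz' : ∀ g, pbF.br z' g = 0 := by
    intro g
    have h1 : ∀ r : ℂ, pbF.br (algebraMap ℂ _ r) g = 0 := by
      intro r
      rw [pbF.antisymm, ← PoissonBracket.ham_apply, Derivation.map_algebraMap, neg_zero]
    rw [map_sub, LinearMap.sub_apply, hz, h1, sub_zero]
  have hz'0 : z' ≠ 0 := by
    intro h0
    apply hcon
    rw [sub_eq_zero.1 h0]
    exact isAlgebraic_algebraMap l
  let J : Ideal A :=
    { carrier := {x | ∃ c ∈ I, ρ x = ρ c * z'}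
      add_mem' := by
        rintro a b ⟨d, hdI, hd⟩ ⟨e, heI, he⟩
        exact ⟨d + e, I.add_mem hdI heI, by rw [map_add, map_add, add_mul, hd, he]⟩
      zero_mem' := ⟨0, I.zero_mem, by simp⟩
      smul_mem' := by
        rintro c x ⟨d, hdI, hd⟩
        exact ⟨c * d, I.mul_mem_left _ hdI, by rw [smul_eq_mul, map_mul, map_mul, mul_assoc, hd]⟩ }
  have hJP : pb.IsPoissonIdeal J := by
    rintro x ⟨c, hc, hx⟩ b
    refine ⟨pb.br c b, hIP c hc b, ?_⟩
    rw [← hρ, ← hρ, hx, pbF.br_mul_left_aux _ _ _ hz']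
  have hJm : J ≤ m := by
    rintro x ⟨c, hc, hx⟩
    have h1 : c0 * x - c * (d0 - algebraMap ℂ A l * c0) ∈ P := by
      rw [← hρ0, map_sub, map_mul, map_mul, hx, map_sub, ← hd0, map_mul, AlgHom.commutes]
      simp only [z']; ring
    have h2 : c0 * x ∈ m := by
      have := m.add_mem (hPm h1) (m.mul_mem_left c hl)
      simpa using this
    exact (hm.isPrime.mem_or_mem h2).resolve_left hc0m
  have hJle := hcore J hJP hJm
  have hx : d0 - algebraMap ℂ A l * c0 ∈ J := by
    refine ⟨c0, ⟨d0, hd0⟩, ?_⟩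
    rw [map_sub, ← hd0, map_mul, AlgHom.commutes]
    simp only [z']; ring
  have h3 := (hρ0 _).2 (hJle hx)
  rw [map_sub, ← hd0, map_mul, AlgHom.commutes] at h3
  have h4 : ρ c0 * z' = 0 := by rw [← h3]; simp only [z']; ring
  rcases mul_eq_zero.1 h4 with h5 | h5
  · exact hc0m (hPm ((hρ0 c0).1 h5))
  · exact hz'0 h5

theorem trace_der {k L M : Type*} [CommRing k] [Field L] [Field M] [Algebra k L] [Algebra k M] [Algebra L M]
    [FiniteDimensional L M] (d : Derivation k L L) (D : Derivation k M M)
    (h : ∀ l, D (algebraMap L M l) = algebraMap L M (d l)) (m : M) :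
    d (Algebra.trace L M m) = Algebra.trace L M (D m) := by
  classical
  let b := Module.finBasis L M
  have hco : ∀ x i, b.repr (D x) i = d (b.repr x i) + ∑ k, b.repr x k * b.repr (D (b k)) i := by
    intro x i
    have h1 : D x = ∑ k, (d (b.repr x k) • b k + b.repr x k • D (b k)) := by
      conv_lhs => rw [← b.sum_repr x]
      rw [map_sum]
      apply Finset.sum_congr rfl
      intro k _
      rw [Algebra.smul_def, Algebra.smul_def, Algebra.smul_def, D.leibniz, h, smul_eq_mul, smul_eq_mul]
      ring
    rw [h1, map_sum, Finset.sum_apply', Finset.sum_congr rfl (fun k _ => by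
      rw [map_add, map_smul, map_smul, Finsupp.add_apply, Finsupp.smul_apply, Finsupp.smul_apply, b.repr_self]),
      Finset.sum_add_distrib]
    congr 1
    simp [Finsupp.single_apply]
  have htr : ∀ x, Algebra.trace L M x = ∑ i, b.repr (x * b i) i := by
    intro x
    rw [Algebra.trace_eq_matrix_trace b, Matrix.trace]
    simp [Algebra.leftMulMatrix_eq_repr_mul]
  have hmul : ∀ x y i, b.repr (x * y) i = ∑ k, b.repr y k * b.repr (x * b k) i := by
    intro x y i
    conv_lhs => rw [← b.sum_repr y]
    rw [Finset.mul_sum, map_sum, Finset.sum_apply']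
    simp
  have hDm : ∀ i, D m * b i = D (m * b i) - m * D (b i) := by
    intro i; rw [D.leibniz, smul_eq_mul, smul_eq_mul]; ring
  rw [htr, htr, map_sum]
  have e1 : ∀ i, b.repr (D m * b i) i = d (b.repr (m * b i) i) +
      ∑ k, b.repr (m * b i) k * b.repr (D (b k)) i - ∑ k, b.repr (D (b i)) k * b.repr (m * b k) i := by
    intro i
    rw [hDm, map_sub, Finsupp.sub_apply, hco, hmul m (D (b i))]
  rw [Finset.sum_congr rfl (fun i _ => e1 i), Finset.sum_sub_distrib, Finset.sum_add_distrib,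
    Finset.sum_comm (f := fun i k => b.repr (D (b i)) k * b.repr (m * b k) i), eq_sub_iff_add_eq]
  congr 1
  apply Finset.sum_congr rfl; intro i _
  apply Finset.sum_congr rfl; intro j _
  ring

theorem dual_one_dim {L K : Type*} [Field L] [Field K] [Algebra L K] [FiniteDimensional L K]
    (φ ψ : K →ₗ[L] L) (hφ : φ ≠ 0) : ∃ f, ∀ g, ψ g = φ (f * g) := by
  let T : K →ₗ[L] Module.Dual L K := LinearMap.mk₂ L (fun f g => φ (f * g))
    (by intros; simp [add_mul]) (by intros; simp) (by intros; simp [mul_add]) (by intros; simp)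
  have hT : ∀ f g, T f g = φ (f * g) := fun f g => rfl
  have hinj : Function.Injective T := by
    rw [injective_iff_map_eq_zero]
    intro f hf
    by_contra hf0
    apply hφ
    ext g
    have := congrArg (fun t => t (f⁻¹ * g)) hf
    simp only [hT, LinearMap.zero_apply] at this
    rwa [mul_inv_cancel_left₀ hf0] at this
  have hsurj : Function.Surjective T :=
    (LinearMap.injective_iff_surjective_of_finrank_eq_finrank (Subspace.dual_finrank_eq).symm).1 hinj
  obtain ⟨f, hf⟩ := hsurj ψ
  exact ⟨f, fun g => by rw [← hf, hT]⟩

theorem der_aeval {k A N σ : Type*} [CommRing k] [CommRing A] [Algebra k A] [AddCommGroup N] [Module A N]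
    [Module k N] [Fintype σ] (D : Derivation k A N) (x : σ → A) (p : MvPolynomial σ k) :
    D (MvPolynomial.aeval x p) = ∑ i, MvPolynomial.aeval x (MvPolynomial.pderiv i p) • D (x i) := by
  classical
  induction p using MvPolynomial.induction_on with
  | C a => simp [MvPolynomial.algHom_C]
  | add p q hp hq => simp [hp, hq, add_smul, Finset.sum_add_distrib]
  | mul_X p i hp =>
    rw [map_mul, D.leibniz, hp, MvPolynomial.aeval_X]
    simp only [Derivation.leibniz, MvPolynomial.pderiv_X, map_add, add_smul, Finset.sum_add_distrib,
      smul_eq_mul, map_mul, MvPolynomial.aeval_X, Finset.smul_sum, mul_smul]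
    congr 1
    rw [Finset.sum_eq_single i]
    · simp
    · intro j _ hj
      rw [Pi.single_eq_of_ne (Ne.symm hj)]; simp
    · simp

theorem totalDegree_pderiv_lt {k σ : Type*} [CommRing k] (i : σ) (p : MvPolynomial σ k)
    (h : MvPolynomial.pderiv i p ≠ 0) :
    (MvPolynomial.pderiv i p).totalDegree < p.totalDegree := by
  classical
  obtain ⟨m, hm⟩ := MvPolynomial.ne_zero_iff.1 h
  have key : ∀ m, MvPolynomial.coeff m (MvPolynomial.pderiv i p) ≠ 0 → (m.sum fun _ e => e) + 1 ≤ p.totalDegree := by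
    intro m hm
    rw [MvPolynomial.coeff_pderiv] at hm
    have h1 : m + Finsupp.single i 1 ∈ p.support := by
      rw [MvPolynomial.mem_support_iff]; intro h0; rw [h0, zero_mul] at hm; exact hm rfl
    have := MvPolynomial.le_totalDegree h1
    rwa [Finsupp.sum_add_index' (by simp) (by simp), Finsupp.sum_single_index rfl] at this
  have hpos : 0 < p.totalDegree := by have := key m hm; omega
  rw [MvPolynomial.totalDegree, Finset.sup_lt_iff (by simpa using hpos)]
  intro m hm
  exact key m (MvPolynomial.mem_support_iff.1 hm)

theorem iterate_pderiv_eq_zero {k σ : Type*} [CommRing k] (i : σ) (d : ℕ) : ∀ (p : MvPolynomial σ k),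
    p.totalDegree < d → (MvPolynomial.pderiv i)^[d] p = 0 := by
  induction d with
  | zero => intro p h; omega
  | succ d ih =>
    intro p h
    rw [Function.iterate_succ_apply]
    by_cases h0 : MvPolynomial.pderiv i p = 0
    · rw [h0]
      exact iterate_map_zero _ _
    · exact ih _ (by have := totalDegree_pderiv_lt i p h0; omega)

theorem eq_C_of_pderiv_zero {k σ : Type*} [Field k] [CharZero k] (p : MvPolynomial σ k)
    (h : ∀ i, MvPolynomial.pderiv i p = 0) : ∃ c, p = MvPolynomial.C c := by
  classical
  refine ⟨MvPolynomial.coeff 0 p, ?_⟩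
  ext m
  rw [MvPolynomial.coeff_C]
  split_ifs with hm
  · rw [← hm]
  · obtain ⟨i, hi⟩ : ∃ i, m i ≠ 0 := by
      by_contra hcon; push Not at hcon
      exact hm (by ext i; simp [hcon i])
    have h1 := MvPolynomial.coeff_pderiv (i := i) p (m - Finsupp.single i 1)
    rw [h i, MvPolynomial.coeff_zero] at h1
    have h2 : m - Finsupp.single i 1 + Finsupp.single i 1 = m := by
      ext j; by_cases hj : i = j
      · subst hj; simp; omega
      · simp [Finsupp.single_apply, hj]
    rw [h2] at h1
    exact (mul_eq_zero.1 h1.symm).resolve_right (Nat.cast_add_one_ne_zero _)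

/-- Lemma: if `D_j x_k = w δ_jk`, `P` prime, `D`-stable, `w ∉ P` then the `x` are independent mod `P`. -/
theorem indep_mod_prime {A σ : Type*} [CommRing A] [Algebra ℂ A] [Fintype σ] [DecidableEq σ] (D : σ → Derivation ℂ A A)
    (x : σ → A) (w : A) (hD : ∀ j k, D j (x k) = if j = k then w else 0) (P : Ideal A) (hP : P.IsPrime)
    (hst : ∀ j, ∀ a ∈ P, D j a ∈ P) (hw : w ∉ P) (p : MvPolynomial σ ℂ)
    (hp : MvPolynomial.aeval x p ∈ P) : p = 0 := by
  induction hn : p.totalDegree using Nat.strong_induction_on generalizing p with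
  | _ n ih =>
    have h1 : ∀ j, MvPolynomial.aeval x (MvPolynomial.pderiv j p) ∈ P := by
      intro j
      have h2 := hst j _ hp
      rw [der_aeval] at h2
      simp only [hD, smul_eq_mul, mul_ite, mul_zero, Finset.sum_ite_eq, Finset.mem_univ, if_true] at h2
      exact (hP.mem_or_mem h2).resolve_right hw
    have h3 : ∀ j, MvPolynomial.pderiv j p = 0 := by
      intro j
      by_contra h0
      exact h0 (ih _ (hn ▸ totalDegree_pderiv_lt j p h0) _ (h1 j) rfl)
    obtain ⟨c, rfl⟩ := eq_C_of_pderiv_zero p h3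
    rw [MvPolynomial.algHom_C] at hp
    by_contra hc
    have hc' : c ≠ 0 := by rintro rfl; simp at hc
    apply hP.ne_top
    apply Ideal.eq_top_of_isUnit_mem _ hp
    exact (IsUnit.mk0 c hc').map _

theorem isInt_aeval {R0 M σ : Type*} [CommRing R0] [Field M] [Algebra R0 M] [Algebra ℂ M] [Fintype σ]
    (hc : ∀ c : ℂ, IsIntegral R0 (algebraMap ℂ M c)) (l : M) (hl : IsIntegral R0 l)
    (z : σ → M) (hz : ∀ i, IsIntegral R0 (l * z i)) (p : MvPolynomial σ ℂ) (n : ℕ)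
    (hn : p.totalDegree ≤ n) : IsIntegral R0 (l ^ n * MvPolynomial.aeval z p) := by
  classical
  rw [MvPolynomial.aeval_def, MvPolynomial.eval₂_eq', Finset.mul_sum]
  apply IsIntegral.sum
  intro m hm
  have h1 := (MvPolynomial.le_totalDegree hm).trans hn
  have h2 : (m.sum fun _ e => e) = ∑ i, m i := Finsupp.sum_fintype _ _ (by simp)
  rw [h2] at h1
  obtain ⟨e, rfl⟩ := Nat.exists_eq_add_of_le h1
  have : l ^ (∑ i, m i + e) * (algebraMap ℂ M (MvPolynomial.coeff m p) * ∏ i, z i ^ m i) =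
      l ^ e * algebraMap ℂ M (MvPolynomial.coeff m p) * ∏ i, (l * z i) ^ m i := by
    simp only [mul_pow, Finset.prod_mul_distrib, pow_add, Finset.prod_pow_eq_pow_sum]
    ring
  rw [this]
  exact ((hl.pow _).mul (hc _)).mul (IsIntegral.prod _ (fun i _ => (hz i).pow _))

theorem isInt_root {R0 M : Type*} [CommRing R0] [Field M] [Algebra R0 M] (q : Polynomial M)
    (hq : q.Monic) (hi : ∀ i, IsIntegral R0 (q.coeff i)) (t : M) (ht : q.eval t = 0) : IsIntegral R0 t := by
  have hO : q ∈ Polynomial.lifts (algebraMap (integralClosure R0 M) M) := by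
    rw [Polynomial.lifts_iff_coeff_lifts]
    intro n
    exact ⟨⟨q.coeff n, hi n⟩, rfl⟩
  obtain ⟨q', hq', -, hm⟩ := Polynomial.lifts_and_degree_eq_and_monic hO hq
  have : IsIntegral (integralClosure R0 M) t := ⟨q', hm, by rw [← Polynomial.eval_map, hq', ht]⟩
  exact isIntegral_trans t this

theorem isInt_y {R0 M : Type*} [CommRing R0] [Field M] [Algebra R0 M] [Algebra ℂ M] 
    (hc : ∀ c : ℂ, IsIntegral R0 (algebraMap ℂ M c)) (l : M) (hl : IsIntegral R0 l)
    (z : Fin 3 → M) (hz1 : IsIntegral R0 (l * z 1)) (hz2 : IsIntegral R0 (l * z 2)) (p : MvPolynomial (Fin 3) ℂ) (n : ℕ)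
    (hn : p.totalDegree ≤ n) (hp : MvPolynomial.coeff (Finsupp.single 0 n) p ≠ 0) (hp0 : MvPolynomial.aeval z p = 0) :
    IsIntegral R0 (l * z 0) := by
  classical
  let c := MvPolynomial.coeff (Finsupp.single 0 n) p
  let cf : (Fin 3 →₀ ℕ) → M := fun m => algebraMap ℂ M (MvPolynomial.coeff m p * c⁻¹) * l ^ (n - (m 0 + m 1 + m 2)) * ((l * z 1) ^ m 1 * (l * z 2) ^ m 2)
  let Q : Polynomial M := ∑ m ∈ p.support, Polynomial.monomial (m 0) (cf m)
  have hdeg : ∀ m ∈ p.support, m 0 + m 1 + m 2 ≤ n := by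
    intro m hm
    have h1 := (MvPolynomial.le_totalDegree hm).trans hn
    have h2 : (m.sum fun _ e => e) = ∑ i, m i := Finsupp.sum_fintype _ _ (by simp)
    rwa [h2, Fin.sum_univ_three] at h1
  have hcoeff : ∀ i, Q.coeff i = ∑ m ∈ p.support, if m 0 = i then cf m else 0 := by
    intro i
    simp only [Q, Polynomial.finsetSum_coeff, Polynomial.coeff_monomial]
  have hcoeffn : Q.coeff n = 1 := by
    rw [hcoeff, Finset.sum_eq_single (Finsupp.single 0 n)]
    · have : (algebraMap ℂ M) c ≠ 0 := by simpa using hp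
      simp [cf]
      exact mul_inv_cancel₀ this
    · intro m hm hne
      rw [if_neg]
      intro h0
      apply hne
      have := hdeg m hm
      ext i
      fin_cases i
      · simpa using h0
      · simp; omega
      · simp; omega
    · intro h
      exact absurd (MvPolynomial.mem_support_iff.2 hp) h
  have hQdeg : Q.natDegree ≤ n := by
    apply Polynomial.natDegree_sum_le_of_forall_le
    intro m hm
    exact (Polynomial.natDegree_monomial_le _).trans (by have := hdeg m hm; omega)
  have hQm : Q.Monic := Polynomial.monic_of_natDegree_le_of_coeff_eq_one n hQdeg hcoeffn
  refine isInt_root Q hQm ?_ _ ?_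
  · intro i
    rw [hcoeff]
    apply IsIntegral.sum
    intro m hm
    split_ifs
    · exact ((hc _).mul (hl.pow _)).mul ((hz1.pow _).mul (hz2.pow _))
    · exact isIntegral_zero
  · have : Q.eval (l * z 0) = algebraMap ℂ M c⁻¹ * l ^ n * MvPolynomial.aeval z p := by
      rw [MvPolynomial.aeval_def, MvPolynomial.eval₂_eq', Finset.mul_sum]
      simp only [Q, Polynomial.eval_finsetSum, Polynomial.eval_monomial]
      apply Finset.sum_congr rfl
      intro m hm
      obtain ⟨e, he⟩ := Nat.exists_eq_add_of_le (hdeg m hm)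
      have he' : n - (m 0 + m 1 + m 2) = e := by omega
      simp only [cf]
      rw [he', Fin.prod_univ_three, he, map_mul]
      ring
    rw [this, hp0, mul_zero]

theorem degree_lemma_elem {A : Type*} [CommRing A] [Algebra ℂ A] (x : Fin 3 → A)
    (a : A) (ha : (MvPolynomial.aeval x : MvPolynomial (Fin 3) ℂ →ₐ[ℂ] A).toRingHom.IsIntegralElem a) :
    ∃ W : ℕ, ∀ {R0 : Type} {M : Type*} [CommRing R0] [Field M] [Algebra R0 M] [Algebra ℂ M]
    (_ : ∀ c : ℂ, IsIntegral R0 (algebraMap ℂ M c)) (l : M) (_ : IsIntegral R0 l) (π : A →ₐ[ℂ] M)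
    (_ : ∀ i, IsIntegral R0 (l * π (x i))), IsIntegral R0 (l ^ W * π a) := by
  obtain ⟨g, hg, hga⟩ := ha
  refine ⟨∑ i ∈ g.support, (g.coeff i).totalDegree, ?_⟩
  set W := ∑ i ∈ g.support, (g.coeff i).totalDegree with hW
  intro R0 M _ _ _ _ hc l hl π hx
  let ev : MvPolynomial (Fin 3) ℂ →ₐ[ℂ] M := MvPolynomial.aeval (fun i => π (x i))
  have hev : ev = π.comp (MvPolynomial.aeval x) := by
    apply MvPolynomial.algHom_ext; intro i; simp [ev]
  let G := (g.map (ev : _ →+* M))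
  have hG : G.Monic := hg.map _
  have hGr : G.eval (π a) = 0 := by
    simp only [G]
    rw [Polynomial.eval_map, hev]
    have := congrArg π hga
    rw [map_zero] at this
    rw [← this]
    exact (Polynomial.hom_eval₂ g _ (π : A →+* M) a).symm
  refine isInt_root (G.scaleRoots (l ^ W)) ((Polynomial.monic_scaleRoots_iff _).2 hG) ?_ _ ?_
  · intro i
    rw [Polynomial.coeff_scaleRoots]
    by_cases hi : i < G.natDegree
    · rw [Polynomial.coeff_map, mul_comm, ← pow_mul]
      apply isInt_aeval hc l hl _ hx
      by_cases hs : i ∈ g.support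
      · have h1 : (g.coeff i).totalDegree ≤ W :=
          Finset.single_le_sum (f := fun i => (g.coeff i).totalDegree) (fun _ _ => Nat.zero_le _) hs
        exact h1.trans (Nat.le_mul_of_pos_right _ (by omega))
      · rw [Polynomial.notMem_support_iff.1 hs]; simp
    · rcases (not_lt.1 hi).eq_or_lt with h | h
      · rw [← h, hG.coeff_natDegree]; simpa using isIntegral_one
      · rw [Polynomial.coeff_eq_zero_of_natDegree_lt h, zero_mul]; exact isIntegral_zero
  · have := Polynomial.scaleRoots_eval₂_eq_zero (p := G) (RingHom.id M) (r := π a) (s := l ^ W) (by rw [Polynomial.eval₂_id]; exact hGr)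
    rwa [RingHom.id_apply, Polynomial.eval₂_id] at this

theorem degree_lemma {A : Type*} [CommRing A] [Algebra ℂ A] (x : Fin 3 → A)
    (ha : (MvPolynomial.aeval x : MvPolynomial (Fin 3) ℂ →ₐ[ℂ] A).toRingHom.IsIntegral) (q : Polynomial A) :
    ∃ W : ℕ, ∀ {R0 : Type} {M : Type*} [CommRing R0] [Field M] [Algebra R0 M] [Algebra ℂ M]
    (_ : ∀ c : ℂ, IsIntegral R0 (algebraMap ℂ M c)) (l : M) (_ : IsIntegral R0 l) (π : A →ₐ[ℂ] M) (Y : M)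
    (_ : ∀ i, IsIntegral R0 (l * π (x i))) (_ : IsIntegral R0 (l * Y)),
      IsIntegral R0 (l ^ W * Polynomial.eval₂ (π : A →+* M) Y q) := by
  induction q using Polynomial.induction_on' with
  | add p q hp hq =>
    obtain ⟨W1, h1⟩ := hp
    obtain ⟨W2, h2⟩ := hq
    refine ⟨W1 + W2, ?_⟩
    intro R0 M _ _ _ _ hc l hl π Y hx hY
    have e1 := (hl.pow W2).mul (h1 hc l hl π Y hx hY)
    have e2 := (hl.pow W1).mul (h2 hc l hl π Y hx hY)
    have := e1.add e2
    rw [Polynomial.eval₂_add]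
    have e3 : l ^ (W1 + W2) * (Polynomial.eval₂ (π : A →+* M) Y p + Polynomial.eval₂ (π : A →+* M) Y q) =
      l ^ W2 * (l ^ W1 * Polynomial.eval₂ (π : A →+* M) Y p) + l ^ W1 * (l ^ W2 * Polynomial.eval₂ (π : A →+* M) Y q) := by
      ring
    rw [e3]
    exact this
  | monomial n a =>
    obtain ⟨W, h⟩ := degree_lemma_elem x a (ha a)
    refine ⟨W + n, ?_⟩
    intro R0 M _ _ _ _ hc l hl π Y hx hY
    have := (h hc l hl π hx).mul (hY.pow n)
    rw [Polynomial.eval₂_monomial]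
    have e3 : l ^ (W + n) * ((π : A →+* M) a * Y ^ n) = l ^ W * π a * (l * Y) ^ n := by
      rw [pow_add, mul_pow, AlgHom.coe_toRingHom]
      ring
    rw [e3]
    exact this

theorem exists_degree_valuation (σ : Type) : ∃ v : Valuation (FractionRing (MvPolynomial σ ℂ)) (WithZero (Multiplicative ℤ)),
    ∀ p : MvPolynomial σ ℂ, p ≠ 0 → v (algebraMap _ _ p) = WithZero.exp (p.totalDegree : ℤ) := by
  classical
  let v : Valuation (MvPolynomial σ ℂ) (WithZero (Multiplicative ℤ)) :=
    { toFun := fun p => if p = 0 then 0 else WithZero.exp (p.totalDegree : ℤ)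
      map_zero' := by simp
      map_one' := by simp
      map_mul' := by
        intro p q
        by_cases hp : p = 0
        · simp [hp]
        by_cases hq : q = 0
        · simp [hq]
        simp only [hp, hq, mul_ne_zero hp hq, if_false]
        rw [MvPolynomial.totalDegree_mul_of_isDomain hp hq, Nat.cast_add, WithZero.exp_add]
      map_add_le_max' := by
        intro p q
        by_cases hp : p = 0
        · simp [hp]
        by_cases hq : q = 0
        · simp [hq]
        by_cases hpq : p + q = 0
        · simp [hpq]
        simp only [hp, hq, hpq, if_false, le_max_iff, WithZero.exp_le_exp, Nat.cast_le]
        have := MvPolynomial.totalDegree_add p q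
        rwa [le_max_iff] at this }
  have hv : ∀ p, p ≠ 0 → v p = WithZero.exp (p.totalDegree : ℤ) := fun p hp => if_neg hp
  have hS : nonZeroDivisors (MvPolynomial σ ℂ) ≤ v.supp.primeCompl := by
    intro p hp h
    have hp0 := nonZeroDivisors.ne_zero hp
    have : v p = 0 := h
    rw [hv p hp0] at this
    exact WithZero.exp_ne_zero this
  refine ⟨v.extendToLocalization hS _, fun p hp => ?_⟩
  rw [Valuation.extendToLocalization_apply_map_apply, hv p hp]

/-- polynomial ring in three variables -/
abbrev R3 : Type := MvPolynomial (Fin 3) ℂ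
/-- rational function field in three variables -/
abbrev L3 : Type := FractionRing R3

theorem trace_bound {A : Type*} [CommRing A] [Algebra ℂ A] (x : Fin 3 → A)
    (ha : (MvPolynomial.aeval x : R3 →ₐ[ℂ] A).toRingHom.IsIntegral) (q : Polynomial A) :
    ∃ W : ℕ, ∀ {M : Type*} [Field M] [Algebra L3 M] [Algebra ℂ M]
      [IsScalarTower ℂ L3 M] 
      [FiniteDimensional L3 M]
      (π : A →ₐ[ℂ] M) 
      (_ : π (x 1) = algebraMap L3 M (algebraMap R3 L3 (MvPolynomial.X (R := ℂ) (σ := Fin 3) 1)))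
      (_ : π (x 2) = algebraMap L3 M (algebraMap R3 L3 (MvPolynomial.X (R := ℂ) (σ := Fin 3) 2)))
      (p : R3) (n : ℕ)
      (_ : p.totalDegree ≤ n) (_ : MvPolynomial.coeff (Finsupp.single 0 n) p ≠ 0)
      (_ : π (MvPolynomial.aeval x p) = 0),
      ∃ r : R3, r.totalDegree ≤ W ∧ Algebra.trace L3 M
        (Polynomial.eval₂ (π : A →+* M) (algebraMap L3 M (algebraMap R3 L3 (MvPolynomial.X (R := ℂ) (σ := Fin 3) 0))) q)
         = algebraMap R3 L3 r := by
  obtain ⟨W, hW⟩ := degree_lemma x ha q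
  refine ⟨W, ?_⟩
  intro M _ _ _ _ _ π hx1 hx2 p n hn hp hp0
  let R := R3
  let L := L3
  let Y : M := algebraMap L M (algebraMap R L (MvPolynomial.X 0))
  let _ : Algebra R M := ((algebraMap L M).comp (algebraMap R L)).toAlgebra
  have tow : IsScalarTower R L M := IsScalarTower.of_algebraMap_eq (fun _ => rfl)
  have hp0' : MvPolynomial.aeval (fun i => π (x i)) p = 0 := by
    rw [← hp0]
    have : (MvPolynomial.aeval (fun i => π (x i)) : R →ₐ[ℂ] M) = π.comp (MvPolynomial.aeval x) := by
      apply MvPolynomial.algHom_ext; intro i; simp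
    rw [this]; rfl
  -- part 1
  have hcR : ∀ c : ℂ, IsIntegral R (algebraMap ℂ M c) := by
    intro c
    rw [IsScalarTower.algebraMap_apply ℂ L M, IsScalarTower.algebraMap_apply ℂ R L]
    exact isIntegral_algebraMap (R := R) (A := M) (x := algebraMap ℂ R c)
  have hXR : ∀ i, IsIntegral R (algebraMap L M (algebraMap R L (MvPolynomial.X i))) := by
    intro i
    exact isIntegral_algebraMap (R := R) (A := M) (x := MvPolynomial.X i)
  have g1 : IsIntegral R ((1 : M) * π (x 1)) := by rw [one_mul, hx1]; exact hXR 1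
  have g2 : IsIntegral R ((1 : M) * π (x 2)) := by rw [one_mul, hx2]; exact hXR 2
  have g0 : IsIntegral R ((1 : M) * π (x 0)) :=
    isInt_y hcR 1 isIntegral_one (fun i => π (x i)) g1 g2 p n hn hp hp0'
  have h1 := hW hcR 1 isIntegral_one π Y (by intro i; fin_cases i; exacts [g0, g1, g2]) (by rw [one_mul]; exact hXR 0)
  rw [one_pow, one_mul] at h1
  obtain ⟨r, hr⟩ := IsIntegrallyClosed.isIntegral_iff.1 (Algebra.isIntegral_trace (L := L) h1)
  refine ⟨r, ?_, hr.symm⟩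
  -- part 2
  obtain ⟨v, hv⟩ := exists_degree_valuation (Fin 3)
  by_cases hr0 : r = 0
  · rw [hr0]; simp
  let V := v.integer
  have hVint : ∀ l : L, v l ≤ 1 → IsIntegral V (algebraMap L M l) := by
    intro l hl
    exact isIntegral_algebraMap (R := V) (A := M) (x := ⟨l, hl⟩)
  have hcV : ∀ c : ℂ, IsIntegral V (algebraMap ℂ M c) := by
    intro c
    rw [IsScalarTower.algebraMap_apply ℂ L M, IsScalarTower.algebraMap_apply ℂ R L]
    apply hVint
    by_cases hc : c = 0
    · simp [hc]
    · rw [hv _ (by simpa using hc)]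
      rw [MvPolynomial.algebraMap_eq, MvPolynomial.totalDegree_C]; simp
  let t : L := (algebraMap R L (MvPolynomial.X 1))⁻¹
  have hX : ∀ i, v (algebraMap R L (MvPolynomial.X i)) = WithZero.exp 1 := by
    intro i; rw [hv _ (MvPolynomial.X_ne_zero i), MvPolynomial.totalDegree_X]; rfl
  have htX : ∀ i, v (t * algebraMap R L (MvPolynomial.X i)) = 1 := by
    intro i
    rw [map_mul, map_inv₀, hX, hX]
    exact inv_mul_cancel₀ WithZero.exp_ne_zero
  have ht : v t ≤ 1 := by
    rw [map_inv₀, hX, ← WithZero.exp_neg, ← WithZero.exp_zero, WithZero.exp_le_exp]; norm_num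
  have hlX : ∀ i, IsIntegral V (algebraMap L M t * algebraMap L M (algebraMap R L (MvPolynomial.X i))) := by
    intro i; rw [← map_mul]; exact hVint _ (htX i).le
  have k1 : IsIntegral V (algebraMap L M t * π (x 1)) := by rw [hx1]; exact hlX 1
  have k2 : IsIntegral V (algebraMap L M t * π (x 2)) := by rw [hx2]; exact hlX 2
  have k0 : IsIntegral V (algebraMap L M t * π (x 0)) :=
    isInt_y hcV _ (hVint _ ht) (fun i => π (x i)) k1 k2 p n hn hp hp0'
  have h2 := hW hcV (algebraMap L M t) (hVint _ ht) π Y (by intro i; fin_cases i; exacts [k0, k1, k2]) (hlX 0)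
  have h3 := Algebra.isIntegral_trace (L := L) h2
  rw [← map_pow, ← Algebra.smul_def, map_smul, ← hr] at h3
  have h4 : v (t ^ W • algebraMap R L r) ≤ 1 := (Valuation.integer.integers v).mem_of_integral h3
  rw [smul_eq_mul, map_mul, map_pow, map_inv₀, hX, hv r hr0, ← WithZero.exp_neg, ← WithZero.exp_nsmul, ← WithZero.exp_add,
    ← WithZero.exp_zero, WithZero.exp_le_exp] at h4
  simp at h4
  omega

/-- image of a variable in an extension of `L3` -/
noncomputable def XM (M : Type*) [Field M] [Algebra L3 M] (i : Fin 3) : M :=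
  algebraMap L3 M (algebraMap R3 L3 (MvPolynomial.X i))

theorem aeval_XM (M : Type*) [Field M] [Algebra L3 M] [Algebra ℂ M] [IsScalarTower ℂ L3 M] (r : R3) :
    MvPolynomial.aeval (XM M) r = algebraMap L3 M (algebraMap R3 L3 r) := by
  have : (MvPolynomial.aeval (XM M) : R3 →ₐ[ℂ] M) =
      (IsScalarTower.toAlgHom ℂ L3 M).comp (IsScalarTower.toAlgHom ℂ R3 L3) := by
    apply MvPolynomial.algHom_ext; intro i; simp [XM]
  rw [this]; rfl

theorem der_extends (M : Type*) [Field M] [Algebra L3 M] [Algebra ℂ M] [IsScalarTower ℂ L3 M]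
    (dd : Derivation ℂ L3 L3) (j : Fin 3) (hdd : ∀ r : R3, dd (algebraMap R3 L3 r) = algebraMap R3 L3 (MvPolynomial.pderiv j r))
    (Dt : Derivation ℂ M M) (hDt : ∀ i, Dt (XM M i) = if i = j then 1 else 0) (l : L3) :
    Dt (algebraMap L3 M l) = algebraMap L3 M (dd l) := by
  have : Dt.compAlgebraMap L3 = (Algebra.linearMap L3 M).compDer dd := by
    apply der_frac_ext (C := R3)
    intro r
    have h1 : Dt.compAlgebraMap L3 (algebraMap R3 L3 r) = Dt (algebraMap L3 M (algebraMap R3 L3 r)) := rfl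
    have h2 : (Algebra.linearMap L3 M).compDer dd (algebraMap R3 L3 r) = algebraMap L3 M (dd (algebraMap R3 L3 r)) := rfl
    rw [h1, h2, hdd, ← aeval_XM, der_aeval, ← aeval_XM]
    simp [hDt]
  exact congrArg (fun T => T l) this

theorem exists_quot {A : Type*} [CommRing A] [Algebra ℂ A] (x : Fin 3 → A) (r : R3) (a : A) :
    ∃ q : Polynomial A, (Polynomial.X - Polynomial.C (x 0)) * q =
      (MvPolynomial.aeval ![Polynomial.X, Polynomial.C (x 1), Polynomial.C (x 2)] r - Polynomial.C (MvPolynomial.aeval x r)) * Polynomial.C a := by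
  have h := Polynomial.X_sub_C_dvd_sub_C_eval (a := x 0)
    (p := (MvPolynomial.aeval ![Polynomial.X, Polynomial.C (x 1), Polynomial.C (x 2)] r : Polynomial A))
  have h2 : Polynomial.eval (x 0) (MvPolynomial.aeval ![Polynomial.X, Polynomial.C (x 1), Polynomial.C (x 2)] r : Polynomial A)
      = MvPolynomial.aeval x r := by
    have : ((Polynomial.aeval (x 0) : Polynomial A →ₐ[A] A).restrictScalars ℂ).comp 
      (MvPolynomial.aeval ![Polynomial.X, Polynomial.C (x 1), Polynomial.C (x 2)] : R3 →ₐ[ℂ] Polynomial A) = MvPolynomial.aeval x := by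
      apply MvPolynomial.algHom_ext; intro i
      fin_cases i <;> simp
    rw [← this]
    simp [Polynomial.coe_aeval_eq_eval]
  rw [h2] at h
  obtain ⟨q, hq⟩ := h
  exact ⟨q * Polynomial.C a, by rw [hq]; ring⟩

theorem per_prime_abs {A : Type*} [CommRing A] [Algebra ℂ A] (x : Fin 3 → A)
    (ha : (MvPolynomial.aeval x : R3 →ₐ[ℂ] A).toRingHom.IsIntegral)
    (D : Fin 2 → Derivation ℂ A A) (w : A)
    (dd : Fin 3 → Derivation ℂ L3 L3) (hdd : ∀ j, ∀ r : R3, dd j (algebraMap R3 L3 r) = algebraMap R3 L3 (MvPolynomial.pderiv j r)) :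
    ∃ Wd : R3 → A → ℕ, ∀ {M : Type*} [Field M] [Algebra L3 M] [Algebra ℂ M] [IsScalarTower ℂ L3 M]
      [FiniteDimensional L3 M] (π : A →ₐ[ℂ] M) (_ : π (x 1) = XM M 1) (_ : π (x 2) = XM M 2)
      (p : R3) (n : ℕ) (_ : p.totalDegree ≤ n) (_ : MvPolynomial.coeff (Finsupp.single 0 n) p ≠ 0)
      (_ : π (MvPolynomial.aeval x p) = 0)
      (P : Ideal A) (_ : ∀ a, π a = 0 ↔ a ∈ P) (_ : w ∉ P) (_ : XM M 0 ≠ π (x 0))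
      (D0 : Derivation ℂ M M) (_ : ∀ a, D0 (π a) = 0) (_ : D0 (XM M 0) = 1)
      (E : Fin 2 → Derivation ℂ M M) (_ : ∀ j a, π w * E j (π a) = π (D j a)) (_ : ∀ j, E j (XM M 0) = 0)
      (_ : ∀ j k, E j (π (x k.succ)) = if k = j then 1 else 0)
      (_ : Submodule.span L3 (Set.range π) = ⊤),
      ∃ c : A →ₗ[ℂ] L3,
        (∀ r a, ∃ s : R3, s.totalDegree ≤ Wd r a ∧ 
          algebraMap R3 L3 r * c a - c (MvPolynomial.aeval x r * a) = algebraMap R3 L3 s) ∧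
        (∀ j g g' g'', w * g' = D j (x 0) * g → w * g'' = D j g → dd j.succ (c g) + dd 0 (c g') = c g'') ∧
        (∀ a ∈ P, c a = 0) ∧
        (∀ θ, θ ∉ P → ¬ ∀ a, ∃ s : R3, c (θ * a) = algebraMap R3 L3 s) := by
  choose q hq using exists_quot x
  choose Wd hWd using fun r a => trace_bound x ha (q r a)
  refine ⟨Wd, ?_⟩
  intro M _ _ _ _ _ π hx1 hx2 p n hn hp hp0 P hker hwP hY D0 hD0 hD0Y E hE hEY hEx hspan
  let u : M := (XM M 0 - π (x 0))⁻¹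
  have hne : XM M 0 - π (x 0) ≠ 0 := sub_ne_zero.2 hY
  have hu0 : u ≠ 0 := inv_ne_zero hne
  let tr := (Algebra.trace L3 M)
  let c : A →ₗ[ℂ] L3 := (tr.restrictScalars ℂ) ∘ₗ (LinearMap.mulRight ℂ u) ∘ₗ π.toLinearMap
  have hc : ∀ a, c a = tr (π a * u) := fun a => rfl
  have hw0 : π w ≠ 0 := fun h => hwP ((hker w).1 h)
  have hder0 : ∀ l, D0 (algebraMap L3 M l) = algebraMap L3 M (dd 0 l) := by
    apply der_extends M (dd 0) 0 (hdd 0)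
    intro i
    fin_cases i
    · simpa using hD0Y
    · simpa [← hx1] using hD0 (x 1)
    · simpa [← hx2] using hD0 (x 2)
  have hderj : ∀ j l, E j (algebraMap L3 M l) = algebraMap L3 M (dd j.succ l) := by
    intro j
    apply der_extends M (dd j.succ) j.succ (hdd j.succ)
    intro i
    fin_cases i
    · exact (hEY j).trans (by fin_cases j <;> simp)
    · change E j (XM M 1) = _
      rw [← hx1]
      exact (hEx j 0).trans (by fin_cases j <;> simp)
    · change E j (XM M 2) = _
      rw [← hx2]
      exact (hEx j 1).trans (by fin_cases j <;> simp <;> decide)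
  have hinv : ∀ (T : Derivation ℂ M M), T u = - u ^ 2 * T (XM M 0 - π (x 0)) := by
    intro T
    have h1 : T (u * (XM M 0 - π (x 0))) = 0 := by
      rw [inv_mul_cancel₀ hne, Derivation.map_one_eq_zero]
    rw [T.leibniz, smul_eq_mul, smul_eq_mul] at h1
    have h2 : u * (XM M 0 - π (x 0)) = 1 := inv_mul_cancel₀ hne
    linear_combination u * h1 - T u * h2
  have hD0u : D0 u = - u ^ 2 := by
    rw [hinv, map_sub, hD0Y, hD0]; ring
  have hD0uk : ∀ (k : ℕ) a, D0 (π a * u ^ (k + 1)) = - ((k : M) + 1) * (π a * u ^ (k + 2)) := by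
    intro k a
    rw [D0.leibniz, hD0, D0.leibniz_pow, hD0u]
    simp only [smul_eq_mul, nsmul_eq_mul, Nat.add_sub_cancel]
    push_cast
    ring
  refine ⟨c, ?_, ?_, ?_, ?_⟩
  · intro r a
    obtain ⟨s, hs, hs'⟩ := hWd r a π hx1 hx2 p n hn hp hp0
    refine ⟨s, hs, ?_⟩
    rw [← hs', hc, hc]
    have h1 := congrArg (Polynomial.eval₂ (π : A →+* M) (XM M 0)) (hq r a)
    have h2 : ∀ r : R3, Polynomial.eval₂ (π : A →+* M) (XM M 0) (MvPolynomial.aeval ![Polynomial.X, Polynomial.C (x 1), Polynomial.C (x 2)] r : Polynomial A) = algebraMap L3 M (algebraMap R3 L3 r) := by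
      intro r
      rw [← aeval_XM]
      induction r using MvPolynomial.induction_on with
      | C a => simp [MvPolynomial.algHom_C, IsScalarTower.algebraMap_apply ℂ A (Polynomial A)]
      | add p q hp hq => rw [map_add, map_add, Polynomial.eval₂_add, hp, hq]
      | mul_X p i hp =>
        rw [map_mul, map_mul, Polynomial.eval₂_mul, hp]
        congr 1
        fin_cases i
        · simp
        · simp [hx1]
        · simp [hx2]
    rw [Polynomial.eval₂_mul, Polynomial.eval₂_mul, Polynomial.eval₂_sub, Polynomial.eval₂_sub, Polynomial.eval₂_X,
      Polynomial.eval₂_C, Polynomial.eval₂_C, Polynomial.eval₂_C, h2] at h1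
    have h3 : Polynomial.eval₂ (π : A →+* M) (XM M 0) (q r a) = (algebraMap R3 L3 r) • (π a * u) - π (MvPolynomial.aeval x r * a) * u := by
      rw [Algebra.smul_def, map_mul]
      have h2 : u * (XM M 0 - π (x 0)) = 1 := inv_mul_cancel₀ hne
      simp only [AlgHom.coe_toRingHom, RingHom.coe_coe] at h1
      linear_combination u * h1 - Polynomial.eval₂ (π : A →+* M) (XM M 0) (q r a) * h2
    change _ = tr (Polynomial.eval₂ (π : A →+* M) (XM M 0) (q r a))
    rw [h3, map_sub, map_smul, smul_eq_mul]
  · intro j g g' g'' h1 h2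
    rw [hc, hc, hc, trace_der _ _ (hderj j), trace_der _ _ hder0, ← map_add]
    congr 1
    have e1 : E j (π g) = π g'' := by
      apply mul_left_cancel₀ hw0
      rw [hE, ← map_mul, h2]
    have e2 : E j (π (x 0)) * π g = π g' := by
      apply mul_left_cancel₀ hw0
      rw [← mul_assoc, hE, ← map_mul, ← map_mul, h1]
    rw [(E j).leibniz, D0.leibniz, hD0, hD0u, hinv, map_sub, hEY, e1]
    simp only [smul_eq_mul]
    linear_combination (u ^ 2) * e2
  · intro a ha
    rw [hc, (hker a).2 ha, zero_mul, map_zero]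
  · intro θ hθ hcon
    have hiter : ∀ k a, (dd 0)^[k] (c a) = (-1) ^ k * (k.factorial : L3) * tr (π a * u ^ (k + 1)) := by
      intro k a
      induction k with
      | zero => simp [hc]
      | succ k ih =>
        rw [Function.iterate_succ_apply', ih, Derivation.leibniz, trace_der _ _ hder0, hD0uk]
        have : dd 0 ((-1) ^ k * (k.factorial : L3)) = 0 := by
          have : ((-1) ^ k * (k.factorial : L3)) = algebraMap ℂ L3 ((-1) ^ k * (k.factorial : ℂ)) := by simp
          rw [this, Derivation.map_algebraMap]
        rw [this, smul_zero, add_zero, smul_eq_mul]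
        have e : (-((k : M) + 1) * (π a * u ^ (k + 2))) = (-((k : L3) + 1)) • (π a * u ^ (k + 2)) := by
          rw [Algebra.smul_def]; simp
        rw [e, map_smul, Nat.factorial_succ, smul_eq_mul]
        push_cast
        ring
    have hS1 : ∀ a, ∃ k0, ∀ k ≥ k0, tr (π a * (π θ * u ^ (k + 1))) = 0 := by
      intro a
      obtain ⟨s, hs⟩ := hcon a
      refine ⟨s.totalDegree + 1, fun k hk => ?_⟩
      have h1 := hiter k (θ * a)
      have h2 : (dd 0)^[k] (c (θ * a)) = algebraMap R3 L3 ((MvPolynomial.pderiv 0)^[k] s) := by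
        rw [hs]
        clear h1 hk
        induction k with
        | zero => rfl
        | succ k ih => rw [Function.iterate_succ_apply', ih, hdd, Function.iterate_succ_apply']
      rw [h2, iterate_pderiv_eq_zero 0 k s (by omega), map_zero] at h1
      have h3 : ((-1) ^ k * (k.factorial : L3)) ≠ 0 := mul_ne_zero (by simp) (by exact_mod_cast k.factorial_ne_zero)
      have h4 := (mul_eq_zero.1 h1.symm).resolve_left h3
      rw [← h4, map_mul π]
      congr 1; ring
    have hS : ∀ m : M, ∃ k0, ∀ k ≥ k0, tr (m * (π θ * u ^ (k + 1))) = 0 := by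
      intro m
      have hm : m ∈ Submodule.span L3 (Set.range π) := by rw [hspan]; trivial
      induction hm using Submodule.span_induction with
      | mem m hm => obtain ⟨a, rfl⟩ := hm; exact hS1 a
      | zero => exact ⟨0, fun k _ => by simp⟩
      | add m m' _ _ h h' =>
        obtain ⟨k, hk⟩ := h
        obtain ⟨k', hk'⟩ := h'
        refine ⟨max k k', fun j hj => ?_⟩
        rw [add_mul, map_add, hk j (le_trans (le_max_left _ _) hj), hk' j (le_trans (le_max_right _ _) hj), add_zero]
      | smul l m _ h =>
        obtain ⟨k, hk⟩ := h
        exact ⟨k, fun j hj => by rw [smul_mul_assoc, map_smul, hk j hj, smul_zero]⟩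
    let b := Module.finBasis L3 M
    choose kb hkb using fun i => hS (b i)
    let K := ∑ i, kb i
    have hall : ∀ m, tr (m * (π θ * u ^ (K + 1))) = 0 := by
      intro m
      rw [← b.sum_repr m, Finset.sum_mul, map_sum]
      apply Finset.sum_eq_zero
      intro i _
      rw [smul_mul_assoc, map_smul, hkb i K (Finset.single_le_sum (f := kb) (fun _ _ => Nat.zero_le _) (Finset.mem_univ i)), smul_zero]
    have h1 := hall (π θ * u ^ (K + 1))⁻¹
    have hθ0 : π θ ≠ 0 := fun h => hθ ((hker θ).1 h)
    rw [inv_mul_cancel₀ (mul_ne_zero hθ0 (pow_ne_zero _ hu0))] at h1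
    have h2 : tr 1 = (Module.finrank L3 M : L3) := by
      have := Algebra.trace_algebraMap (R := L3) (S := M) 1
      simpa using this
    rw [h2] at h1
    have h3 : Module.finrank L3 M = 0 := by exact_mod_cast h1
    exact Module.finrank_pos.ne' h3

theorem quot_der {A : Type*} [CommRing A] [Algebra ℂ A] (D : Derivation ℂ A A) (P : Ideal A)
    (h : ∀ a ∈ P, D a ∈ P) :
    ∃ Db : Derivation ℂ (A ⧸ P) (A ⧸ P), ∀ a, Db (Ideal.Quotient.mk P a) = Ideal.Quotient.mk P (D a) := by
  let s : A ⧸ P → A := Function.surjInv Ideal.Quotient.mk_surjective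
  have hs : ∀ b, Ideal.Quotient.mk P (s b) = b := Function.surjInv_eq Ideal.Quotient.mk_surjective
  let f : A ⧸ P → A ⧸ P := fun b => Ideal.Quotient.mk P (D (s b))
  have hf : ∀ a, f (Ideal.Quotient.mk P a) = Ideal.Quotient.mk P (D a) := by
    intro a
    have h1 : s (Ideal.Quotient.mk P a) - a ∈ P := by
      rw [← Ideal.Quotient.eq_zero_iff_mem, map_sub, hs, sub_self]
    have h2 := h _ h1
    rw [map_sub] at h2
    exact Ideal.Quotient.eq.2 h2
  have hadd : ∀ b b', f (b + b') = f b + f b' := by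
    intro b b'
    obtain ⟨a, rfl⟩ := Ideal.Quotient.mk_surjective b
    obtain ⟨a', rfl⟩ := Ideal.Quotient.mk_surjective b'
    rw [← map_add, hf, hf, hf, map_add, map_add]
  have hsmul : ∀ (c : ℂ) b, f (c • b) = c • f b := by
    intro c b
    obtain ⟨a, rfl⟩ := Ideal.Quotient.mk_surjective b
    have : c • Ideal.Quotient.mk P a = Ideal.Quotient.mk P (c • a) := rfl
    rw [this, hf, hf, D.map_smul]
    rfl
  refine ⟨Derivation.mk' { toFun := f, map_add' := hadd, map_smul' := hsmul } ?_, hf⟩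
  intro b b'
  obtain ⟨a, rfl⟩ := Ideal.Quotient.mk_surjective b
  obtain ⟨a', rfl⟩ := Ideal.Quotient.mk_surjective b'
  change f _ = _ • f _ + _ • f _
  rw [← map_mul, hf, hf, hf, D.leibniz]
  simp

theorem poly_der {B : Type*} [CommRing B] [Algebra ℂ B] (D : Derivation ℂ B B) :
    ∃ T : Derivation ℂ (Polynomial B) (Polynomial B), (∀ b, T (Polynomial.C b) = Polynomial.C (D b)) ∧
      T Polynomial.X = 0 := by
  let f : Polynomial B → Polynomial B := fun p => p.sum fun n a => Polynomial.monomial n (D a)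
  have hf : ∀ n p, (f p).coeff n = D (p.coeff n) := by
    intro n p
    simp only [f, Polynomial.sum_def, Polynomial.finsetSum_coeff, Polynomial.coeff_monomial]
    rw [Finset.sum_ite_eq']
    split_ifs with h
    · rfl
    · rw [Polynomial.notMem_support_iff.1 h, map_zero]
  refine ⟨Derivation.mk' { toFun := f, map_add' := ?_, map_smul' := ?_ } ?_, ?_, ?_⟩
  · intro p q; ext n; simp [hf]
  · intro c p; ext n; simp [hf]
  · intro p q
    ext n
    change (f _).coeff n = (p • f q + q • f p).coeff n
    rw [hf, Polynomial.coeff_mul, map_sum, Polynomial.coeff_add, smul_eq_mul, smul_eq_mul, Polynomial.coeff_mul, mul_comm q, Polynomial.coeff_mul,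
      ← Finset.sum_add_distrib]
    apply Finset.sum_congr rfl
    intro i _
    rw [D.leibniz, hf, hf]
    simp [mul_comm]
  · intro b
    ext n
    change (f _).coeff n = _
    rw [hf, Polynomial.coeff_C, Polynomial.coeff_C]
    split_ifs <;> simp
  · ext n
    change (f _).coeff n = _
    rw [hf, Polynomial.coeff_X]
    split_ifs <;> simp

theorem span_fin {A L M : Type*} [CommRing A] [Algebra ℂ A] [Field L] [Field M] [Algebra L M] [Algebra ℂ L]
    [Algebra ℂ M] [IsScalarTower ℂ L M] (hfg : Algebra.FiniteType ℂ A) (π : A →ₐ[ℂ] M)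
    (hi : ∀ a, IsIntegral L (π a))
    (h : ∀ S : Subalgebra L M, (∀ a, π a ∈ S) → (∀ s ∈ S, s⁻¹ ∈ S) → S = ⊤) :
    FiniteDimensional L M ∧ Submodule.span L (Set.range π) = ⊤ := by
  obtain ⟨t, ht⟩ := hfg.out
  let S := Algebra.adjoin L (π '' (t : Set A))
  have hfin : Module.Finite L S := Algebra.finite_adjoin_of_finite_of_isIntegral (t.finite_toSet.image _)
    (by rintro _ ⟨a, _, rfl⟩; exact hi a)
  have hS : ∀ a, π a ∈ S := by
    intro a
    have ha : a ∈ Algebra.adjoin ℂ (t : Set A) := by rw [ht]; trivial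
    have h1 : Algebra.adjoin ℂ (t : Set A) ≤ (S.restrictScalars ℂ).comap π := by
      apply Algebra.adjoin_le
      intro b hb
      exact Algebra.subset_adjoin ⟨b, hb, rfl⟩
    exact h1 ha
  have hIntg : ∀ s : S, IsIntegral L s := fun s => Algebra.IsIntegral.isIntegral s
  have hST : S = ⊤ := by
    apply h S hS
    intro s hs
    have := hIntg ⟨s, hs⟩
    exact S.inv_mem_of_algebraic (x := ⟨s, hs⟩) ((this.map S.val).isAlgebraic)
  constructor
  · rw [hST] at hfin
    exact Module.Finite.equiv (Subalgebra.topEquiv (R := L) (A := M)).toLinearEquiv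
  · have h1 : Algebra.adjoin L (Set.range π) = ⊤ := by
      rw [eq_top_iff, ← hST]
      apply Algebra.adjoin_mono
      rintro _ ⟨a, _, rfl⟩
      exact ⟨a, rfl⟩
    have h2 := Algebra.adjoin_eq_span (R := L) (s := Set.range π)
    have h3 : ((Submonoid.closure (Set.range π) : Submonoid M) : Set M) = Set.range π := by
      have : Set.range π = ((MonoidHom.mrange (π : A →* M) : Submonoid M) : Set M) := rfl
      rw [this, Submonoid.closure_eq]
    rw [h3, h1] at h2
    rw [← h2]; rfl

theorem fin3_inj {B : Type*} [CommRing B] [Algebra ℂ B] (z : Fin 2 → B)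
    (hz : ∀ p : MvPolynomial (Fin 2) ℂ, MvPolynomial.aeval z p = 0 → p = 0) :
    Function.Injective (MvPolynomial.aeval ![Polynomial.X, Polynomial.C (z 0), Polynomial.C (z 1)] : R3 →ₐ[ℂ] Polynomial B) := by
  have h1 : (MvPolynomial.aeval ![Polynomial.X, Polynomial.C (z 0), Polynomial.C (z 1)] : R3 →ₐ[ℂ] Polynomial B) =
      (Polynomial.mapAlgHom (MvPolynomial.aeval z : MvPolynomial (Fin 2) ℂ →ₐ[ℂ] B)).comp
        (MvPolynomial.finSuccEquiv ℂ 2).toAlgHom := by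
    apply MvPolynomial.algHom_ext
    intro i
    refine Fin.cases ?_ (fun i => ?_) i
    · simp [MvPolynomial.finSuccEquiv_X_zero]
    · fin_cases i
      · simpa using (congrArg (Polynomial.map (MvPolynomial.aeval z : MvPolynomial (Fin 2) ℂ →ₐ[ℂ] B).toRingHom) (MvPolynomial.finSuccEquiv_X_succ (R := ℂ) (j := (0 : Fin 2)))).symm
      · simpa using (congrArg (Polynomial.map (MvPolynomial.aeval z : MvPolynomial (Fin 2) ℂ →ₐ[ℂ] B).toRingHom) (MvPolynomial.finSuccEquiv_X_succ (R := ℂ) (j := (1 : Fin 2)))).symm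
  rw [h1]
  have h2 : Function.Injective (Polynomial.mapAlgHom (MvPolynomial.aeval z : MvPolynomial (Fin 2) ℂ →ₐ[ℂ] B)) :=
    Polynomial.map_injective _ ((injective_iff_map_eq_zero _).2 hz)
  exact h2.comp (MvPolynomial.finSuccEquiv ℂ 2).injective

theorem per_prime {A : Type*} [CommRing A] [Algebra ℂ A] (hfg : Algebra.FiniteType ℂ A) (x : Fin 3 → A)
    (ha : (MvPolynomial.aeval x : R3 →ₐ[ℂ] A).toRingHom.IsIntegral)
    (D : Fin 2 → Derivation ℂ A A) (w : A) (hD : ∀ j k : Fin 2, D j (x k.succ) = if j = k then w else 0)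
    (dd : Fin 3 → Derivation ℂ L3 L3) (hdd : ∀ j, ∀ r : R3, dd j (algebraMap R3 L3 r) = algebraMap R3 L3 (MvPolynomial.pderiv j r)) :
    ∃ Wd : R3 → A → ℕ, ∀ P : Ideal A, P.IsPrime → (∀ j, ∀ a ∈ P, D j a ∈ P) → w ∉ P →
      ∀ (p : R3) (n : ℕ) (_ : p.totalDegree ≤ n) (_ : MvPolynomial.coeff (Finsupp.single 0 n) p ≠ 0)
      (_ : MvPolynomial.aeval x p ∈ P),
      ∃ c : A →ₗ[ℂ] L3,
        (∀ r a, ∃ s : R3, s.totalDegree ≤ Wd r a ∧ 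
          algebraMap R3 L3 r * c a - c (MvPolynomial.aeval x r * a) = algebraMap R3 L3 s) ∧
        (∀ j g g' g'', w * g' = D j (x 0) * g → w * g'' = D j g → dd j.succ (c g) + dd 0 (c g') = c g'') ∧
        (∀ a ∈ P, c a = 0) ∧
        (∀ θ, θ ∉ P → ¬ ∀ a, ∃ s : R3, c (θ * a) = algebraMap R3 L3 s) := by
  obtain ⟨Wd, hWd⟩ := per_prime_abs x ha D w dd hdd
  refine ⟨Wd, ?_⟩
  intro P hP hst hw p n hn hp hp0
  let B := A ⧸ P
  let C := Polynomial B
  let M := FractionRing C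
  have hM : ∀ c : C, algebraMap C M c = 0 → c = 0 := fun c hc => (IsFractionRing.injective C M) (by rw [hc, map_zero])
  let z : Fin 2 → B := fun k => Ideal.Quotient.mk P (x k.succ)
  have hz : ∀ p : MvPolynomial (Fin 2) ℂ, MvPolynomial.aeval z p = 0 → p = 0 := by
    intro p hp
    apply indep_mod_prime D (fun k => x k.succ) w hD P hP hst hw p
    rw [← Ideal.Quotient.eq_zero_iff_mem, ← hp]
    have : (Ideal.Quotient.mkₐ ℂ P).comp (MvPolynomial.aeval fun k => x k.succ) = MvPolynomial.aeval z := by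
      apply MvPolynomial.algHom_ext; intro i; simp [z]
    rw [← this]; rfl
  let f : R3 →ₐ[ℂ] C := MvPolynomial.aeval ![Polynomial.X, Polynomial.C (z 0), Polynomial.C (z 1)]
  have hf : Function.Injective f := fin3_inj z hz
  let fM : R3 →ₐ[ℂ] M := (IsScalarTower.toAlgHom ℂ C M).comp f
  have hfM : Function.Injective fM := (IsFractionRing.injective C M).comp hf
  let F : L3 →ₐ[ℂ] M := IsFractionRing.liftAlgHom hfM
  have hF : ∀ r, F (algebraMap R3 L3 r) = fM r := fun r => IsFractionRing.lift_algebraMap hfM r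
  letI : Algebra L3 M := F.toRingHom.toAlgebra
  have hFa : ∀ l, algebraMap L3 M l = F l := fun l => rfl
  haveI : IsScalarTower ℂ L3 M := IsScalarTower.of_algebraMap_eq' F.comp_algebraMap.symm
  let π : A →ₐ[ℂ] M := (IsScalarTower.toAlgHom ℂ C M).comp ((IsScalarTower.toAlgHom ℂ B C).comp (Ideal.Quotient.mkₐ ℂ P))
  have hπ : ∀ a, π a = algebraMap C M (Polynomial.C (Ideal.Quotient.mk P a)) := fun a => rfl
  have hX0 : XM M 0 = algebraMap C M Polynomial.X := by
    change F _ = _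
    rw [hF]; simp [fM, f]
  have hx1 : π (x 1) = XM M 1 := by
    change _ = F _
    rw [hF]; simp [fM, f, z, hπ]
  have hx2 : π (x 2) = XM M 2 := by
    change _ = F _
    rw [hF]; simp [fM, f, z, hπ]
  have hp0' : π (MvPolynomial.aeval x p) = 0 := by
    rw [hπ, Ideal.Quotient.eq_zero_iff_mem.2 hp0, map_zero, map_zero]
  have hcint : ∀ c : ℂ, IsIntegral L3 (algebraMap ℂ M c) := fun c => by
    rw [IsScalarTower.algebraMap_apply ℂ L3 M]; exact isIntegral_algebraMap
  have hLint : ∀ i, IsIntegral L3 (XM M i) := fun i => isIntegral_algebraMap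
  have hπx : ∀ i, IsIntegral L3 (1 * π (x i)) := by
    have h1 : IsIntegral L3 (1 * π (x 1)) := by rw [hx1, one_mul]; exact hLint 1
    have h2 : IsIntegral L3 (1 * π (x 2)) := by rw [hx2, one_mul]; exact hLint 2
    have h0 : IsIntegral L3 (1 * π (x 0)) := by
      apply isInt_y hcint 1 isIntegral_one (fun i => π (x i)) h1 h2 p n hn hp
      rw [← hp0']
      have : (MvPolynomial.aeval fun i => π (x i)) = π.comp (MvPolynomial.aeval x) := by
        apply MvPolynomial.algHom_ext; intro i; simp
      rw [this]; rfl
    intro i; fin_cases i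
    · exact h0
    · exact h1
    · exact h2
  have hIntg : ∀ a, IsIntegral L3 (π a) := by
    intro a
    obtain ⟨W, hW⟩ := degree_lemma_elem x a (ha a)
    simpa using hW hcint 1 isIntegral_one π hπx
  obtain ⟨hfin, hspan⟩ := span_fin hfg π hIntg (by
    intro S hS hinv
    rw [eq_top_iff]
    rintro m -
    have hC : ∀ c : C, algebraMap C M c ∈ S := by
      intro c
      induction c using Polynomial.induction_on' with
      | add p q hp hq => rw [map_add]; exact S.add_mem hp hq
      | monomial n b =>
        obtain ⟨a, rfl⟩ := Ideal.Quotient.mk_surjective b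
        rw [← Polynomial.C_mul_X_pow_eq_monomial, map_mul, map_pow, ← hπ, ← hX0]
        exact S.mul_mem (hS a) (S.pow_mem (S.algebraMap_mem _) _)
    obtain ⟨a, b, -, rfl⟩ := IsFractionRing.div_surjective (A := C) m
    rw [div_eq_mul_inv]
    exact S.mul_mem (hC a) (hinv _ (hC b)))
  have hker : ∀ a, π a = 0 ↔ a ∈ P := by
    intro a
    rw [hπ, ← Ideal.Quotient.eq_zero_iff_mem]
    constructor
    · intro h
      exact Polynomial.C_eq_zero.1 (hM _ h)
    · intro h; rw [h, map_zero, map_zero]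
  have hY : XM M 0 ≠ π (x 0) := by
    rw [hX0, hπ]
    intro h
    have := IsFractionRing.injective C M h
    exact Polynomial.X_ne_C _ this
  -- derivations
  obtain ⟨D0, hD0⟩ := der_ext_frac (k := ℂ) (C := C) (F := M) (N := M)
    ((Algebra.linearMap C M).compDer ((Polynomial.derivative' (R := B)).restrictScalars ℂ))
  have hD0' : ∀ c : C, D0 (algebraMap C M c) = algebraMap C M (Polynomial.derivative c) := fun c => hD0 c
  choose Db hDb using fun j => quot_der (D j) P (hst j)
  choose T hTC hTX using fun j => poly_der (Db j)
  choose E hE using fun j => der_ext_frac (k := ℂ) (C := C) (F := M) (N := M) ((Algebra.linearMap C M).compDer (T j))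
  have hE' : ∀ j (c : C), E j (algebraMap C M c) = algebraMap C M (T j c) := fun j c => hE j c
  have hw0 : π w ≠ 0 := fun h => hw ((hker w).1 h)
  have hEπ : ∀ j a, E j (π a) = π (D j a) := by
    intro j a
    rw [hπ, hE', hTC, hDb, hπ]
  refine hWd π hx1 hx2 p n hn hp hp0' P hker hw hY D0 ?_ ?_ (fun j => (π w)⁻¹ • E j) ?_ ?_ ?_ hspan
  · intro a; rw [hπ, hD0']; simp
  · rw [hX0, hD0']; simp
  · intro j a
    rw [Derivation.smul_apply, smul_eq_mul, hEπ, mul_inv_cancel_left₀ hw0]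
  · intro j
    rw [Derivation.smul_apply, hX0, hE', hTX, map_zero, smul_zero]
  · intro j k
    rw [Derivation.smul_apply, hEπ, hD, smul_eq_mul]
    by_cases h : j = k
    · rw [if_pos h, if_pos h.symm, inv_mul_cancel₀ hw0]
    · rw [if_neg h, if_neg (Ne.symm h), map_zero, mul_zero]

theorem delta_on_L {A K : Type*} [CommRing A] [Algebra ℂ A] [Field K] [Algebra ℂ K] [Algebra A K] [IsScalarTower ℂ A K]
    [Algebra L3 K] [IsScalarTower ℂ L3 K] (x : Fin 3 → A)
    (hc : ∀ r : R3, algebraMap L3 K (algebraMap R3 L3 r) = algebraMap A K (MvPolynomial.aeval x r))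
    (D : Fin 2 → Derivation ℂ A A) (w : A) (hw : algebraMap A K w ≠ 0) (hD : ∀ j k : Fin 2, D j (x k.succ) = if j = k then w else 0)
    (dd : Fin 3 → Derivation ℂ L3 L3) (hdd : ∀ j, ∀ r : R3, dd j (algebraMap R3 L3 r) = algebraMap R3 L3 (MvPolynomial.pderiv j r))
    (δ : Fin 2 → Derivation ℂ K K) (hδ : ∀ j a, algebraMap A K w * δ j (algebraMap A K a) = algebraMap A K (D j a))
    (j : Fin 2) (l : L3) :
    δ j (algebraMap L3 K l) = algebraMap L3 K (dd j.succ l) + δ j (algebraMap A K (x 0)) * algebraMap L3 K (dd 0 l) := by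
  have hX : ∀ i, algebraMap A K (x i) = algebraMap L3 K (algebraMap R3 L3 (MvPolynomial.X i)) := by
    intro i; rw [hc]; simp
  have hδx : ∀ k : Fin 2, δ j (algebraMap A K (x k.succ)) = if j = k then 1 else 0 := by
    intro k
    apply mul_left_cancel₀ hw
    rw [hδ, hD]
    split_ifs <;> simp
  have : (δ j).compAlgebraMap L3 = (Algebra.linearMap L3 K).compDer (dd j.succ)
     + δ j (algebraMap A K (x 0)) • (Algebra.linearMap L3 K).compDer (dd 0) := by
    apply der_frac_ext (C := R3)
    intro r
    have h1 : (δ j).compAlgebraMap L3 (algebraMap R3 L3 r) = δ j (algebraMap L3 K (algebraMap R3 L3 r)) := rfl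
    have h2 : ∀ i, (Algebra.linearMap L3 K).compDer (dd i) (algebraMap R3 L3 r) = algebraMap L3 K (dd i (algebraMap R3 L3 r)) := fun i => rfl
    rw [h1, Derivation.add_apply, Derivation.smul_apply, h2, h2, hdd, hdd, ← aeval_XM, ← aeval_XM, ← aeval_XM, der_aeval, Fin.sum_univ_three]
    have e0 : XM K 0 = algebraMap A K (x 0) := (hX 0).symm
    have e1 : XM K 1 = algebraMap A K (x (0 : Fin 2).succ) := (hX 1).symm
    have e2 : XM K 2 = algebraMap A K (x (1 : Fin 2).succ) := (hX 2).symm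
    rw [e1, e2, hδx, hδx, e0]
    fin_cases j
    · simp [smul_eq_mul]; ring
    · simp [smul_eq_mul]; ring
  exact congrArg (fun T => T l) this

theorem star_span {K : Type*} [Field K] [Algebra ℂ K] [Algebra L3 K] [IsScalarTower ℂ L3 K]
    (d0 d1 : Derivation ℂ L3 L3) (δ : Derivation ℂ K K) (b : K)
    (hδ : ∀ l : L3, δ (algebraMap L3 K l) = algebraMap L3 K (d1 l) + b * algebraMap L3 K (d0 l))
    (φ : K →ₗ[L3] L3) (G : Set K) (hG : Submodule.span L3 G = ⊤)
    (h : ∀ g ∈ G, d1 (φ g) + d0 (φ (b * g)) = φ (δ g)) (g : K) :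
    d1 (φ g) + d0 (φ (b * g)) = φ (δ g) := by
  have hm : g ∈ Submodule.span L3 G := by rw [hG]; trivial
  induction hm using Submodule.span_induction with
  | mem g hg => exact h g hg
  | zero => simp
  | add g g' _ _ h h' =>
    rw [mul_add, map_add, map_add, map_add, map_add, map_add, map_add, ← h, ← h']; ring
  | smul l g _ h =>
    rw [Algebra.smul_def, δ.leibniz, hδ]
    have e1 : algebraMap L3 K l • δ g + g • (algebraMap L3 K (d1 l) + b * algebraMap L3 K (d0 l)) =
      l • δ g + d1 l • g + d0 l • (b * g) := by
      simp only [Algebra.smul_def, smul_eq_mul, Algebra.algebraMap_self, RingHom.id_apply]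
      ring
    have e2 : b * (algebraMap L3 K l * g) = l • (b * g) := by rw [Algebra.smul_def]; ring
    have e3 : algebraMap L3 K l * g = l • g := by rw [Algebra.smul_def]
    rw [e1, e2, e3, map_add, map_add]
    simp only [φ.map_smul]
    rw [← h]
    simp only [smul_eq_mul, Derivation.leibniz]
    ring

theorem star_pair {K : Type*} [Field K] [Algebra ℂ K] [Algebra L3 K] [IsScalarTower ℂ L3 K] [FiniteDimensional L3 K]
    {ι : Type*} (d0 : Derivation ℂ L3 L3) (d1 : ι → Derivation ℂ L3 L3) (δ : ι → Derivation ℂ K K) (b : ι → K)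
    (φ ψ : K →ₗ[L3] L3) (hφ0 : φ ≠ 0) (hind : ∀ z : ℂ, ψ ≠ z • φ)
    (hφ : ∀ j g, d1 j (φ g) + d0 (φ (b j * g)) = φ (δ j g))
    (hψ : ∀ j g, d1 j (ψ g) + d0 (ψ (b j * g)) = ψ (δ j g)) :
    ∃ f : K, ¬ IsAlgebraic ℂ f ∧ ∀ j, δ j f = 0 := by
  obtain ⟨f, hf⟩ := dual_one_dim φ ψ hφ0
  refine ⟨f, ?_, ?_⟩
  · intro halg
    have : f ∈ (⊥ : Subalgebra ℂ K) := by
      have h1 := IsAlgClosed.degree_eq_one_of_irreducible ℂ (minpoly.irreducible halg.isIntegral)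
      exact minpoly.mem_range_of_degree_eq_one ℂ f h1
    obtain ⟨z, hz⟩ := Algebra.mem_bot.1 this
    apply hind z
    ext g
    rw [hf, ← hz, LinearMap.smul_apply, IsScalarTower.algebraMap_apply ℂ L3 K, ← Algebra.smul_def, map_smul, algebraMap_smul]
  · intro j
    by_contra hne
    apply hφ0
    ext g
    have h1 := hψ j (g / δ j f)
    have h2 := hφ j (f * (g / δ j f))
    rw [hf, hf, hf] at h1
    rw [(δ j).leibniz, map_add] at h2
    have e : (g / δ j f) • δ j f = g := by rw [smul_eq_mul, div_mul_cancel₀ _ hne]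
    have e3 : f * (b j * (g / δ j f)) = b j * (f * (g / δ j f)) := by ring
    rw [e, smul_eq_mul] at h2
    rw [e3] at h1
    rw [LinearMap.zero_apply]
    linear_combination h1 - h2

theorem universal_s {A K κ : Type*} [Fintype κ] [CommRing A] [Algebra ℂ A] [Field K] [Algebra A K]
    [Algebra L3 K] (hinj : Function.Injective (algebraMap A K)) (hfg : Algebra.FiniteType ℂ A) (x : Fin 3 → A)
    (ha : (MvPolynomial.aeval x : R3 →ₐ[ℂ] A).toRingHom.IsIntegral)
    (hc : ∀ r : R3, algebraMap L3 K (algebraMap R3 L3 r) = algebraMap A K (MvPolynomial.aeval x r))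
    (w : A) (hw : w ≠ 0) (e : Module.Basis κ L3 K) (ak : κ → A) (hak : ∀ k, e k = algebraMap A K (ak k)) :
    ∃ s : R3, s ≠ 0 ∧ ∀ a, ∃ r : κ → R3, MvPolynomial.aeval x s * a = w * ∑ k, MvPolynomial.aeval x (r k) * ak k := by
  let al : Algebra R3 A := (MvPolynomial.aeval x : R3 →ₐ[ℂ] A).toRingHom.toAlgebra
  have hal : ∀ r : R3, algebraMap R3 A r = MvPolynomial.aeval x r := fun r => rfl
  have tw : IsScalarTower ℂ R3 A := IsScalarTower.of_algebraMap_eq' (MvPolynomial.aeval x : R3 →ₐ[ℂ] A).comp_algebraMap.symm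
  have ft : Algebra.FiniteType R3 A := Algebra.FiniteType.of_restrictScalars_finiteType ℂ R3 A
  have hi : Algebra.IsIntegral R3 A := ⟨ha⟩
  have hfin : Module.Finite R3 A := Algebra.IsIntegral.finite
  obtain ⟨t, ht⟩ := hfin.fg_top
  have hw' : algebraMap A K w ≠ 0 := fun h => hw (hinj (by rw [h, map_zero]))
  obtain ⟨b, hb⟩ := IsLocalization.exist_integer_multiples_of_finite (S := L3) (nonZeroDivisors R3)
    (fun i : t × κ => e.repr (algebraMap A K i.1 / algebraMap A K w) i.2)
  refine ⟨b, nonZeroDivisors.ne_zero b.2, ?_⟩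
  intro a
  have hat : a ∈ Submodule.span R3 (t : Set A) := by rw [ht]; trivial
  induction hat using Submodule.span_induction with
  | mem g hg =>
    choose r hr using fun k => hb (⟨g, hg⟩, k)
    refine ⟨r, hinj ?_⟩
    have h1 : algebraMap A K g / algebraMap A K w = ∑ k, e.repr (algebraMap A K g / algebraMap A K w) k • e k := (e.sum_repr _).symm
    rw [map_mul, map_mul, map_sum]
    have h2 : ∀ k, algebraMap A K (MvPolynomial.aeval x (r k) * ak k) =
       algebraMap A K (MvPolynomial.aeval x (b : R3)) * (e.repr (algebraMap A K g / algebraMap A K w) k • e k) := by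
      intro k
      have := hr k
      simp only at this
      rw [map_mul, ← hc, this, Algebra.smul_def, map_mul, hc, hak, Algebra.smul_def, mul_assoc]
    rw [Finset.sum_congr rfl (fun k _ => h2 k), ← Finset.mul_sum, ← h1]
    field_simp
  | zero => exact ⟨0, by simp⟩
  | add a a' _ _ h h' =>
    obtain ⟨r, hr⟩ := h
    obtain ⟨r', hr'⟩ := h'
    refine ⟨r + r', ?_⟩
    rw [mul_add, hr, hr', ← mul_add, ← Finset.sum_add_distrib]
    simp [add_mul]
  | smul l a _ h =>
    obtain ⟨r, hr⟩ := h
    refine ⟨fun k => l * r k, ?_⟩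
    rw [Algebra.smul_def, hal, mul_left_comm, hr, mul_left_comm, Finset.mul_sum]
    simp [mul_assoc]

theorem ker_pair {J : Type*} [Fintype J] (Wb : J → ℕ) :
    ∃ m : ℕ, ∀ v : Fin m → J → L3, (∀ n j, ∃ s : R3, s.totalDegree ≤ Wb j ∧ v n j = algebraMap R3 L3 s) →
      ∃ c c' : Fin m → ℂ, LinearIndependent ℂ ![c, c'] ∧ (∀ j, ∑ n, c n • v n j = 0) ∧ (∀ j, ∑ n, c' n • v n j = 0) := by
  let U : J → Type := fun j => MvPolynomial.restrictTotalDegree (Fin 3) ℂ (Wb j)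
  let V := (j : J) → MvPolynomial.restrictTotalDegree (Fin 3) ℂ (Wb j)
  refine ⟨Module.finrank ℂ V + 2, ?_⟩
  intro v hv
  choose s hs hs' using hv
  let T : (Fin (Module.finrank ℂ V + 2) → ℂ) →ₗ[ℂ] V := Fintype.linearCombination ℂ
    (fun n j => ⟨s n j, (MvPolynomial.mem_restrictTotalDegree _ _ _).2 (hs n j)⟩)
  have h1 : 1 < Module.finrank ℂ (LinearMap.ker T) := by
    have h2 := LinearMap.finrank_range_add_finrank_ker T
    have h3 := Submodule.finrank_le (LinearMap.range T)
    rw [Module.finrank_fin_fun] at h2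
    omega
  have : Nontrivial (LinearMap.ker T) := Module.nontrivial_of_finrank_pos (by omega : 0 < Module.finrank ℂ (LinearMap.ker T))
  obtain ⟨c, hc0⟩ := exists_ne (0 : LinearMap.ker T)
  obtain ⟨c', hcc⟩ := exists_linearIndependent_pair_of_one_lt_finrank h1 hc0
  have hker : ∀ c ∈ LinearMap.ker T, ∀ j, ∑ n, c n • v n j = 0 := by
    intro c hc j
    have h4 : T c = 0 := hc
    let ev : V →ₗ[ℂ] L3 := (IsScalarTower.toAlgHom ℂ R3 L3).toLinearMap ∘ₗ
      (MvPolynomial.restrictTotalDegree (Fin 3) ℂ (Wb j)).subtype ∘ₗ LinearMap.proj j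
    have h5 := congrArg ev h4
    rw [map_zero] at h5
    simp only [T, Fintype.linearCombination_apply] at h5
    rw [map_sum] at h5
    rw [← h5]
    apply Finset.sum_congr rfl
    intro n _
    rw [hs', ev.map_smul]
    rfl
  refine ⟨c, c', ?_, hker c c.2, hker c' c'.2⟩
  have := hcc.map' (LinearMap.ker T).subtype (Submodule.ker_subtype _)
  have e : ![(c : Fin (Module.finrank ℂ V + 2) → ℂ), c'] = (LinearMap.ker T).subtype ∘ ![c, c'] := by
    funext i
    fin_cases i <;> rfl
  rw [e]
  exact this

theorem exists_mem_others {A : Type*} [CommRing A] {m : ℕ} (Pn : Fin m → Ideal A) (hpr : ∀ n, (Pn n).IsPrime)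
    (hinc : ∀ n n', Pn n ≤ Pn n' → n = n') (n0 : Fin m) : ∃ g, g ∉ Pn n0 ∧ ∀ n, n ≠ n0 → g ∈ Pn n := by
  classical
  have h1 : ∀ n, ∃ g, n ≠ n0 → g ∈ Pn n ∧ g ∉ Pn n0 := by
    intro n
    by_cases h : n = n0
    · exact ⟨0, fun h' => absurd h h'⟩
    · have : ¬ Pn n ≤ Pn n0 := fun h' => h (hinc _ _ h')
      obtain ⟨g, hg, hg'⟩ := SetLike.not_le_iff_exists.1 this
      exact ⟨g, fun _ => ⟨hg, hg'⟩⟩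
  choose g hg using h1
  refine ⟨∏ n ∈ Finset.univ.erase n0, g n, ?_, ?_⟩
  · intro h
    obtain ⟨n, hn, hn'⟩ := (hpr n0).prod_mem_iff.1 h
    exact (hg n (Finset.ne_of_mem_erase hn)).2 hn'
  · intro n hn
    exact Ideal.mem_of_dvd _ (Finset.dvd_prod_of_mem g (Finset.mem_erase.2 ⟨hn, Finset.mem_univ n⟩)) (hg n hn).1

theorem core {A K : Type*} [CommRing A] [IsDomain A] [Algebra ℂ A] [Field K] [Algebra ℂ K] [Algebra A K] [IsScalarTower ℂ A K]
    [IsFractionRing A K] (hfg : Algebra.FiniteType ℂ A) (x : Fin 3 → A)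
    (hxinj : Function.Injective (MvPolynomial.aeval x : R3 →ₐ[ℂ] A))
    (ha : (MvPolynomial.aeval x : R3 →ₐ[ℂ] A).toRingHom.IsIntegral)
    (D : Fin 2 → Derivation ℂ A A) (w : A) (hw0 : w ≠ 0) (hD : ∀ j k : Fin 2, D j (x k.succ) = if j = k then w else 0)
    (δ : Fin 2 → Derivation ℂ K K) (hδ : ∀ j a, algebraMap A K w * δ j (algebraMap A K a) = algebraMap A K (D j a))
    (S : Set (Ideal A)) (hS : S.Infinite) (hpr : ∀ P ∈ S, P.IsPrime) (hst : ∀ P ∈ S, ∀ j, ∀ a ∈ P, D j a ∈ P)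
    (hwP : ∀ P ∈ S, w ∉ P) (hp : ∀ P ∈ S, ∃ (p : R3) (n : ℕ), p.totalDegree ≤ n ∧ 
      MvPolynomial.coeff (Finsupp.single 0 n) p ≠ 0 ∧ MvPolynomial.aeval x p ∈ P)
    (hfinS : ∀ a : A, a ≠ 0 → {P ∈ S | a ∈ P}.Finite) (hinc : ∀ P ∈ S, ∀ Q ∈ S, P ≤ Q → P = Q) :
    ∃ f : K, ¬ IsAlgebraic ℂ f ∧ ∀ j, δ j f = 0 := by
  classical
  have hAK : Function.Injective (algebraMap A K) := IsFractionRing.injective A K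
  let fM : R3 →ₐ[ℂ] K := (IsScalarTower.toAlgHom ℂ A K).comp (MvPolynomial.aeval x)
  have hfM : Function.Injective fM := hAK.comp hxinj
  let F : L3 →ₐ[ℂ] K := IsFractionRing.liftAlgHom hfM
  have hF : ∀ r, F (algebraMap R3 L3 r) = fM r := fun r => IsFractionRing.lift_algebraMap hfM r
  let _al : Algebra L3 K := F.toRingHom.toAlgebra
  have tw : IsScalarTower ℂ L3 K := IsScalarTower.of_algebraMap_eq' F.comp_algebraMap.symm
  have hc : ∀ r : R3, algebraMap L3 K (algebraMap R3 L3 r) = algebraMap A K (MvPolynomial.aeval x r) := fun r => hF r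
  have hIntg : ∀ a, IsIntegral L3 (algebraMap A K a) := by
    intro a
    obtain ⟨g, hm, hg⟩ := ha a
    refine ⟨g.map (algebraMap R3 L3), hm.map _, ?_⟩
    have h1 := congrArg (algebraMap A K) hg
    rw [Polynomial.hom_eval₂, map_zero] at h1
    rw [Polynomial.eval₂_map, ← h1]
    congr 1
    ext r
    · simp [hc]
    · simp [hc]
  obtain ⟨hfd, hspan⟩ := span_fin hfg (IsScalarTower.toAlgHom ℂ A K) (L := L3) hIntg (by
    intro S hS hinv
    rw [eq_top_iff]
    rintro m -
    obtain ⟨a, b, -, rfl⟩ := IsFractionRing.div_surjective (A := A) m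
    rw [div_eq_mul_inv]
    exact S.mul_mem (hS a) (hinv _ (hS b)))
  choose dd hdd0 using fun j => der_ext_frac (k := ℂ) (C := R3) (F := L3) (N := L3)
    ((Algebra.linearMap R3 L3).compDer (MvPolynomial.pderiv j))
  have hdd : ∀ j, ∀ r : R3, dd j (algebraMap R3 L3 r) = algebraMap R3 L3 (MvPolynomial.pderiv j r) := fun j r => hdd0 j r
  obtain ⟨κ, fi, e, he⟩ : ∃ (κ : Type _) (_ : Fintype κ) (e : Module.Basis κ L3 K), ∀ k, ∃ a, e k = algebraMap A K a := by
    refine ⟨_, Module.Basis.fintypeIndexOfRankLtAleph0 (Module.Basis.ofSpan hspan.ge) (Module.rank_lt_aleph0 L3 K), 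
      Module.Basis.ofSpan hspan.ge, ?_⟩
    intro k
    obtain ⟨a, h⟩ := Module.Basis.ofSpan_subset hspan.ge ⟨k, rfl⟩
    exact ⟨a, h.symm⟩
  choose ak hak using he
  obtain ⟨Wd, hWd⟩ := per_prime hfg x ha D w hD dd hdd
  obtain ⟨s, hs0, hs⟩ := universal_s hAK hfg x ha hc w hw0 e ak hak
  have hιs : MvPolynomial.aeval x s ≠ 0 := fun h => hs0 (hxinj (by rw [h, map_zero]))
  choose rr hrr using hs
  set σ := MvPolynomial.aeval x s with hσ
  let rt : Option (Fin 2 × Bool) → κ → κ → R3 := fun t i k =>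
    match t with
    | none => if i = k then s * s else 0
    | some (j, false) => rr (D j (x 0) * (σ * ak i)) k
    | some (j, true) => rr (2 * D j σ * ak i + σ * D j (ak i)) k
  obtain ⟨m, hm⟩ := ker_pair (fun t : Option (Fin 2 × Bool) × κ × κ => Wd (rt t.1 t.2.1 t.2.2) (ak t.2.2))
  have hS' : (S \ {P ∈ S | σ ∈ P}).Infinite := hS.diff (hfinS σ hιs)
  let em := hS'.natEmbedding
  let Pn : Fin m → Ideal A := fun n => em n
  have hPS : ∀ n, Pn n ∈ S := fun n => (em n).2.1
  have hPσ : ∀ n, σ ∉ Pn n := fun n h => (em n).2.2 ⟨hPS n, h⟩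
  have hPinc : ∀ n n', Pn n ≤ Pn n' → n = n' := by
    intro n n' h
    have := hinc _ (hPS n) _ (hPS n') h
    exact Fin.ext (em.injective (Subtype.ext this))
  choose! pp nn hp1 hp2 hp3 using hp
  have hPn := fun n => hWd (Pn n) (hpr _ (hPS n)) (hst _ (hPS n)) (hwP _ (hPS n)) (pp (Pn n)) (nn (Pn n))
    (hp1 _ (hPS n)) (hp2 _ (hPS n)) (hp3 _ (hPS n))
  choose cP hca hcb hcc hcd using hPn
  obtain ⟨c1, c2, hli, hc1, hc2⟩ := hm (fun n t => algebraMap R3 L3 (rt t.1 t.2.1 t.2.2) * cP n (ak t.2.2) -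
    cP n (MvPolynomial.aeval x (rt t.1 t.2.1 t.2.2) * ak t.2.2)) (fun n t => by
      obtain ⟨s, h1, h2⟩ := hca n (rt t.1 t.2.1 t.2.2) (ak t.2.2)
      exact ⟨s, h1, h2⟩)
  let CC : (Fin m → ℂ) → (A →ₗ[ℂ] L3) := fun c => ∑ n, c n • cP n
  have hCC : ∀ c a, CC c a = ∑ n, c n • cP n a := fun c a => by simp [CC]
  let Φ : (Fin m → ℂ) → (K →ₗ[L3] L3) := fun c => e.constr L3 (fun k => CC c (ak k))
  have hΦe : ∀ c k, Φ c (algebraMap A K (ak k)) = CC c (ak k) := by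
    intro c k
    rw [← hak]
    exact e.constr_basis _ _ _
  have hΦsum : ∀ c (r : κ → R3), Φ c (algebraMap A K (∑ k, MvPolynomial.aeval x (r k) * ak k)) =
      ∑ k, algebraMap R3 L3 (r k) * CC c (ak k) := by
    intro c r
    rw [map_sum, map_sum]
    apply Finset.sum_congr rfl
    intro k _
    rw [map_mul, ← hc, ← Algebra.smul_def, (Φ c).map_smul, hΦe, smul_eq_mul]
  -- polynomial defects
  have hpoly : ∀ c r a, ∃ q : R3, algebraMap R3 L3 r * CC c a - CC c (MvPolynomial.aeval x r * a) = algebraMap R3 L3 q := by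
    intro c r a
    choose q _ hq using fun n => hca n r a
    refine ⟨∑ n, c n • q n, ?_⟩
    rw [hCC, hCC, Finset.mul_sum, ← Finset.sum_sub_distrib, map_sum]
    apply Finset.sum_congr rfl
    intro n _
    rw [Algebra.smul_def (c n) (q n), map_mul (algebraMap R3 L3), ← hq, ← IsScalarTower.algebraMap_apply, Algebra.smul_def, Algebra.smul_def]
    ring
  have hzero : ∀ c, Φ c = 0 → c = 0 := by
    intro c hc0
    by_contra hne
    obtain ⟨n0, hn0⟩ := Function.ne_iff.1 hne
    obtain ⟨g, hg, hg'⟩ := exists_mem_others Pn (fun n => hpr _ (hPS n)) hPinc n0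
    have hak0 : ∀ k, CC c (ak k) = 0 := fun k => by rw [← hΦe, hc0]; rfl
    apply hcd n0 (σ * g)
    · intro h
      rcases (hpr _ (hPS n0)).mem_or_mem h with h | h
      · exact hPσ n0 h
      · exact hg h
    · intro a
      have h1 : σ * (g * a) = ∑ k, MvPolynomial.aeval x (rr (g * a * w) k) * ak k := by
        have := hrr (g * a * w)
        apply mul_left_cancel₀ hw0
        rw [← this]; ring
      have h2 : ∃ q : R3, CC c (σ * (g * a)) = algebraMap R3 L3 q := by
        choose q hq using fun k => hpoly c (rr (g * a * w) k) (ak k)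
        refine ⟨∑ k, - q k, ?_⟩
        rw [h1, map_sum, map_sum]
        apply Finset.sum_congr rfl
        intro k _
        rw [map_neg, ← hq, hak0]; ring
      have h3 : CC c (σ * (g * a)) = c n0 • cP n0 (σ * g * a) := by
        rw [hCC, Finset.sum_eq_single n0, mul_assoc]
        · intro n _ hn
          rw [hcc n _ (by rw [mul_left_comm]; exact Ideal.mul_mem_right _ _ (hg' n hn)), smul_zero]
        · simp
      obtain ⟨q, hq⟩ := h2
      refine ⟨(c n0)⁻¹ • q, ?_⟩
      rw [Algebra.smul_def, map_mul (algebraMap R3 L3), ← IsScalarTower.algebraMap_apply, ← Algebra.smul_def, ← hq, h3, inv_smul_smul₀ hn0]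
  have hwK : algebraMap A K w ≠ 0 := fun h => hw0 (hAK (by rw [h, map_zero]))
  have hstar : ∀ c, (∀ t i k, algebraMap R3 L3 (rt t i k) * CC c (ak k) = CC c (MvPolynomial.aeval x (rt t i k) * ak k)) →
      ∀ j g, dd j.succ (Φ c g) + dd 0 (Φ c (δ j (algebraMap A K (x 0)) * g)) = Φ c (δ j g) := by
    intro c hcv j
    have hcv' : ∀ t i, Φ c (algebraMap A K (∑ k, MvPolynomial.aeval x (rt t i k) * ak k)) =
        CC c (∑ k, MvPolynomial.aeval x (rt t i k) * ak k) := by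
      intro t i
      rw [hΦsum, map_sum]
      exact Finset.sum_congr rfl (fun k _ => hcv t i k)
    apply star_span (dd 0) (dd j.succ) (δ j) _ (delta_on_L x hc D w hwK hD dd hdd δ hδ j) (Φ c)
      (Set.range fun i => algebraMap A K (σ * σ * ak i))
    · rw [eq_top_iff, ← e.span_eq]
      apply Submodule.span_le.2
      rintro _ ⟨i, rfl⟩
      have h1 : e i = (algebraMap R3 L3 (s * s))⁻¹ • algebraMap A K (σ * σ * ak i) := by
        have h0 : (algebraMap R3 L3 (s * s)) ≠ 0 := fun h => (mul_ne_zero hs0 hs0) (IsFractionRing.injective R3 L3 (by rw [h, map_zero]))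
        rw [eq_inv_smul_iff₀ h0, hak, Algebra.smul_def, hc, ← map_mul, map_mul (MvPolynomial.aeval x)]
      rw [h1]
      exact Submodule.smul_mem _ _ (Submodule.subset_span ⟨i, rfl⟩)
    · rintro _ ⟨i, rfl⟩
      have e0 : σ * σ * ak i = ∑ k, MvPolynomial.aeval x (rt none i k) * ak k := by
        simp only [rt]
        rw [Finset.sum_eq_single i]
        · rw [if_pos rfl, map_mul]
        · intro k _ hk; rw [if_neg (Ne.symm hk)]; simp
        · simp
      set g := σ * σ * ak i with hg
      set g' := ∑ k, MvPolynomial.aeval x (rt (some (j, false)) i k) * ak k with hg'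
      set g'' := ∑ k, MvPolynomial.aeval x (rt (some (j, true)) i k) * ak k with hg''
      have e1 : w * g' = D j (x 0) * g := by
        rw [hg', ← hrr]; ring
      have e2 : w * g'' = D j g := by
        rw [hg'', ← hrr, hg, (D j).leibniz, (D j).leibniz]
        simp only [smul_eq_mul]; ring
      have e3 : δ j (algebraMap A K (x 0)) * algebraMap A K g = algebraMap A K g' := by
        apply mul_left_cancel₀ hwK
        rw [← mul_assoc, hδ, ← map_mul, ← map_mul, e1]
      have e4 : δ j (algebraMap A K g) = algebraMap A K g'' := by
        apply mul_left_cancel₀ hwK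
        rw [hδ, ← map_mul, e2]
      have e5 : Φ c (algebraMap A K g) = CC c g := by rw [e0]; exact hcv' none i
      have e6 : Φ c (algebraMap A K g') = CC c g' := hcv' (some (j, false)) i
      have e7 : Φ c (algebraMap A K g'') = CC c g'' := hcv' (some (j, true)) i
      rw [e3, e4, e5, e6, e7, hCC, hCC, hCC, map_sum, map_sum, ← Finset.sum_add_distrib]
      apply Finset.sum_congr rfl
      intro n _
      rw [Derivation.map_smul, Derivation.map_smul, ← smul_add, hcb n j g g' g'' e1 e2]
  have hconv : ∀ c : Fin m → ℂ, (∀ t : Option (Fin 2 × Bool) × κ × κ, ∑ n, c n • (algebraMap R3 L3 (rt t.1 t.2.1 t.2.2) * cP n (ak t.2.2) -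
    cP n (MvPolynomial.aeval x (rt t.1 t.2.1 t.2.2) * ak t.2.2)) = 0) → 
      ∀ t i k, algebraMap R3 L3 (rt t i k) * CC c (ak k) = CC c (MvPolynomial.aeval x (rt t i k) * ak k) := by
    intro c hcv t i k
    have := hcv (t, i, k)
    rw [← sub_eq_zero, ← this, hCC, hCC, Finset.mul_sum, ← Finset.sum_sub_distrib]
    apply Finset.sum_congr rfl
    intro n _
    rw [smul_sub, mul_smul_comm]
  have hpair := LinearIndependent.pair_iff.1 hli
  apply star_pair (dd 0) (fun j : Fin 2 => dd j.succ) δ (fun j => δ j (algebraMap A K (x 0))) (Φ c1) (Φ c2) ?_ ?_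
    (hstar c1 (hconv c1 hc1)) (hstar c2 (hconv c2 hc2))
  · intro h
    have h1 := hzero c1 h
    have := hpair 1 0 (by rw [h1]; simp)
    exact one_ne_zero this.1
  · intro z h
    have h1 : Φ (c2 - z • c1) = 0 := by
      apply e.ext
      intro k
      have h2 := congrArg (fun T => T (algebraMap A K (ak k))) h
      simp only [LinearMap.smul_apply, hΦe] at h2
      rw [hak, hΦe, hCC, LinearMap.zero_apply]
      rw [hCC, hCC] at h2
      simp only [Pi.sub_apply, Pi.smul_apply, sub_smul, Finset.sum_sub_distrib, h2, Finset.smul_sum, smul_eq_mul, mul_smul, sub_self]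
    have h2 := hzero _ h1
    have := hpair (-z) 1 (by rw [← h2]; simp; ring)
    exact one_ne_zero this.2

theorem inc_aux {A : Type*} [CommRing A] [IsDomain A] [Algebra ℂ A] (x : Fin 3 → A)
    (hxinj : Function.Injective (MvPolynomial.aeval x : R3 →ₐ[ℂ] A))
    (ha : (MvPolynomial.aeval x : R3 →ₐ[ℂ] A).toRingHom.IsIntegral)
    (Q P : Ideal A) (hQ : Q.IsPrime) (hQP : Q ≤ P) (hQ0 : Q ≠ ⊥)
    (hind : ∀ p : MvPolynomial (Fin 2) ℂ, MvPolynomial.aeval (fun k : Fin 2 => x k.succ) p ∈ P → p = 0) : Q = P := by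
  obtain ⟨r, hr0, hr⟩ : ∃ r : R3, r ≠ 0 ∧ MvPolynomial.aeval x r ∈ Q := by
    letI : Algebra R3 A := (MvPolynomial.aeval x : R3 →ₐ[ℂ] A).toRingHom.toAlgebra
    haveI : Algebra.IsIntegral R3 A := ⟨ha⟩
    by_contra hcon
    push Not at hcon
    apply hQ0
    apply Ideal.eq_bot_of_comap_eq_bot (R := R3)
    rw [eq_bot_iff]
    intro p hp
    by_contra h
    exact hcon p h hp
  apply le_antisymm hQP
  intro b hb
  by_contra hbQ
  let xb : Fin 3 → A ⧸ Q := fun i => Ideal.Quotient.mk Q (x i)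
  let φ : MvPolynomial (Fin 2) ℂ →ₐ[ℂ] A ⧸ Q := MvPolynomial.aeval (fun k : Fin 2 => xb k.succ)
  have hφ : ∀ p, φ p = Ideal.Quotient.mk Q (MvPolynomial.aeval (fun k : Fin 2 => x k.succ) p) := by
    intro p
    have : φ = (Ideal.Quotient.mkₐ ℂ Q).comp (MvPolynomial.aeval (fun k : Fin 2 => x k.succ)) := by
      ext i; simp [φ, xb]
    rw [this]; rfl
  letI : Algebra (MvPolynomial (Fin 2) ℂ) (A ⧸ Q) := φ.toRingHom.toAlgebra
  have halg : ∀ p, algebraMap (MvPolynomial (Fin 2) ℂ) (A ⧸ Q) p = φ p := fun p => rfl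
  haveI : IsScalarTower ℂ (MvPolynomial (Fin 2) ℂ) (A ⧸ Q) := IsScalarTower.of_algebraMap_eq (fun c => by
    rw [halg, MvPolynomial.algebraMap_eq]; exact (MvPolynomial.algHom_C φ c).symm)
  have hfs : ∀ p : R3, Polynomial.aeval (xb 0) (MvPolynomial.finSuccEquiv ℂ 2 p) = Ideal.Quotient.mk Q (MvPolynomial.aeval x p) := by
    intro p
    have : ((Polynomial.aeval (R := MvPolynomial (Fin 2) ℂ) (xb 0)).restrictScalars ℂ).comp (MvPolynomial.finSuccEquiv ℂ 2 : R3 →ₐ[ℂ] _) =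
        (Ideal.Quotient.mkₐ ℂ Q).comp (MvPolynomial.aeval x) := by
      ext i
      refine Fin.cases ?_ (fun j => ?_) i
      · simp [MvPolynomial.finSuccEquiv_X_zero, xb]
      · simp [MvPolynomial.finSuccEquiv_X_succ, xb, halg, φ]
    exact DFunLike.congr_fun this p
  have hx0 : IsAlgebraic (MvPolynomial (Fin 2) ℂ) (xb 0) := by
    refine ⟨MvPolynomial.finSuccEquiv ℂ 2 r, ?_, ?_⟩
    · simpa using hr0
    · rw [hfs]; exact Ideal.Quotient.eq_zero_iff_mem.2 hr
  let T := Subalgebra.algebraicClosure (MvPolynomial (Fin 2) ℂ) (A ⧸ Q)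
  have hxT : ∀ p : R3, Ideal.Quotient.mk Q (MvPolynomial.aeval x p) ∈ T := by
    intro p
    rw [← hfs]
    exact (Algebra.adjoin_le (Set.singleton_subset_iff.2 hx0)) (Polynomial.aeval_mem_adjoin_singleton (MvPolynomial (Fin 2) ℂ) (xb 0))
  have hbint : IsIntegral T (Ideal.Quotient.mk Q b) := by
    obtain ⟨q, hq, hq0⟩ := ha b
    let ψ : R3 →+* T := ((Ideal.Quotient.mk Q).comp (MvPolynomial.aeval x : R3 →ₐ[ℂ] A).toRingHom).codRestrict T hxT
    refine ⟨q.map ψ, hq.map _, ?_⟩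
    rw [Polynomial.eval₂_map]
    have : (algebraMap T (A ⧸ Q)).comp ψ = (Ideal.Quotient.mk Q).comp (MvPolynomial.aeval x : R3 →ₐ[ℂ] A).toRingHom := rfl
    rw [this, ← Polynomial.hom_eval₂, hq0, map_zero]
  have hbalg : IsAlgebraic (MvPolynomial (Fin 2) ℂ) (Ideal.Quotient.mk Q b) :=
    IsIntegral.trans_isAlgebraic (MvPolynomial (Fin 2) ℂ) hbint
  have hne := Ideal.comap_ne_bot_of_algebraic_mem (I := P.map (Ideal.Quotient.mk Q))
    (fun h => hbQ (Ideal.Quotient.eq_zero_iff_mem.1 h)) (Ideal.mem_map_of_mem _ hb) hbalg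
  apply hne
  rw [eq_bot_iff]
  intro p hp
  rw [Ideal.mem_comap, halg, hφ] at hp
  rw [Ideal.mem_bot]
  apply hind
  have := Ideal.mem_comap.2 hp
  rwa [Ideal.comap_map_mk hQP] at this

theorem vanish {A K σ : Type*} [CommRing A] [IsDomain A] [Algebra ℂ A] [Field K] [Algebra ℂ K] [Algebra A K]
    [IsScalarTower ℂ A K] [IsFractionRing A K] [Fintype σ] (x : σ → A)
    (hxinj : Function.Injective (MvPolynomial.aeval x : MvPolynomial σ ℂ →ₐ[ℂ] A))
    (ha : (MvPolynomial.aeval x : MvPolynomial σ ℂ →ₐ[ℂ] A).toRingHom.IsIntegral)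
    (T : Derivation ℂ K K) (hT : ∀ i, T (algebraMap A K (x i)) = 0) : T = 0 := by
  apply der_frac_zero (C := A)
  letI : Algebra (MvPolynomial σ ℂ) A := (MvPolynomial.aeval x : MvPolynomial σ ℂ →ₐ[ℂ] A).toRingHom.toAlgebra
  haveI : Algebra.IsIntegral (MvPolynomial σ ℂ) A := ⟨ha⟩
  haveI : FaithfulSMul (MvPolynomial σ ℂ) A := (faithfulSMul_iff_algebraMap_injective _ _).2 hxinj
  haveI : Module.IsTorsionFree A K := inferInstance
  intro c
  have h := der_zero_of_algebraic (R := MvPolynomial σ ℂ) (T.compAlgebraMap A) (fun p => by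
    change (T.compAlgebraMap A) (MvPolynomial.aeval x p) = 0
    rw [der_aeval]
    apply Finset.sum_eq_zero
    intro i _
    change _ • T (algebraMap A K (x i)) = 0
    rw [hT, smul_zero]) c (Algebra.IsIntegral.isIntegral c).isAlgebraic
  exact h

theorem PoissonBracket.br_self {A : Type*} [CommRing A] [Algebra ℂ A] (pb : PoissonBracket ℂ A) (a : A) : pb.br a a = 0 := by
  have h := pb.antisymm a a
  have h2 : (2 : ℂ) • pb.br a a = 0 := by
    rw [two_smul]; nth_rewrite 1 [h]; simp
  have := congrArg (fun z => (2⁻¹ : ℂ) • z) h2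
  simpa [smul_smul] using this

theorem good_finite {B K : Type*} [CommRing B] [IsDomain B] [Algebra ℂ B] [Field K] [Algebra ℂ K] [Algebra B K]
    [IsScalarTower ℂ B K] [IsFractionRing B K] (hfg : Algebra.FiniteType ℂ B)
    (pb : PoissonBracket ℂ B) (pbF : PoissonBracket ℂ K)
    (hc : ∀ a b, pbF.br (algebraMap B K a) (algebraMap B K b) = algebraMap B K (pb.br a b))
    (hrat : ∀ f : K, (∀ g, pbF.br f g = 0) → IsAlgebraic ℂ f)
    (x : Fin 3 → B) (hxinj : Function.Injective (MvPolynomial.aeval x : R3 →ₐ[ℂ] B))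
    (ha : (MvPolynomial.aeval x : R3 →ₐ[ℂ] B).toRingHom.IsIntegral)
    (S : Set (Ideal B)) (hpr : ∀ P ∈ S, P.IsPrime) (hS0 : ∀ P ∈ S, P ≠ ⊥) (hst : ∀ P ∈ S, pb.IsPoissonIdeal P)
    (hwP : ∀ P ∈ S, pb.br (x 1) (x 2) ∉ P)
    (hp : ∀ P ∈ S, ∃ (p : R3) (n : ℕ), p.totalDegree ≤ n ∧ MvPolynomial.coeff (Finsupp.single 0 n) p ≠ 0 ∧ MvPolynomial.aeval x p ∈ P) :
    S.Finite := by
  by_contra hS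
  replace hS : S.Infinite := hS
  obtain ⟨P0, hP0⟩ := hS.nonempty
  have hw0 : pb.br (x 1) (x 2) ≠ 0 := fun h => hwP P0 hP0 (by rw [h]; exact P0.zero_mem)
  have hwK : algebraMap B K (pb.br (x 1) (x 2)) ≠ 0 := by
    rwa [Ne, map_eq_zero_iff _ (IsFractionRing.injective B K)]
  let D : Fin 2 → Derivation ℂ B B := ![-(pb.ham (x 2)), pb.ham (x 1)]
  let δ : Fin 2 → Derivation ℂ K K := ![(algebraMap B K (pb.br (x 1) (x 2)))⁻¹ • -(pbF.ham (algebraMap B K (x 2))),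
    (algebraMap B K (pb.br (x 1) (x 2)))⁻¹ • pbF.ham (algebraMap B K (x 1))]
  have hD : ∀ j k : Fin 2, D j (x k.succ) = if j = k then pb.br (x 1) (x 2) else 0 := by
    intro j k
    fin_cases j <;> fin_cases k <;> simp [D, PoissonBracket.ham_apply, pb.br_self]
    exact (pb.antisymm _ _).symm
  have hDst : ∀ P ∈ S, ∀ j, ∀ a ∈ P, D j a ∈ P := by
    intro P hP j a ha
    have h1 : ∀ b, pb.br b a ∈ P := fun b => by
      rw [pb.antisymm]; exact P.neg_mem (hst P hP a ha b)
    fin_cases j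
    · exact P.neg_mem (h1 (x 2))
    · exact h1 (x 1)
  have hδ : ∀ j a, algebraMap B K (pb.br (x 1) (x 2)) * δ j (algebraMap B K a) = algebraMap B K (D j a) := by
    intro j a
    fin_cases j
    · change _ * ((algebraMap B K (pb.br (x 1) (x 2)))⁻¹ * -(pbF.br (algebraMap B K (x 2)) (algebraMap B K a))) = algebraMap B K (-(pb.br (x 2) a))
      rw [mul_inv_cancel_left₀ hwK, hc, map_neg]
    · change _ * ((algebraMap B K (pb.br (x 1) (x 2)))⁻¹ * (pbF.br (algebraMap B K (x 1)) (algebraMap B K a))) = algebraMap B K ((pb.br (x 1) a))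
      rw [mul_inv_cancel_left₀ hwK, hc]
  have hind : ∀ P ∈ S, ∀ p : MvPolynomial (Fin 2) ℂ, MvPolynomial.aeval (fun k : Fin 2 => x k.succ) p ∈ P → p = 0 := by
    intro P hP p hp
    exact indep_mod_prime D _ _ hD P (hpr P hP) (hDst P hP) (hwP P hP) p hp
  haveI : IsNoetherianRing B := Algebra.FiniteType.isNoetherianRing ℂ B
  have hfinS : ∀ a : B, a ≠ 0 → {P ∈ S | a ∈ P}.Finite := by
    intro a ha0
    apply ((Ideal.span {a}).finite_minimalPrimes_of_isNoetherianRing).subset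
    rintro P ⟨hP, haP⟩
    haveI := hpr P hP
    obtain ⟨Q, hQ, hQP⟩ := Ideal.exists_minimalPrimes_le (I := Ideal.span {a}) (J := P) ((Ideal.span_singleton_le_iff_mem _).2 haP)
    have : Q = P := inc_aux x hxinj ha Q P hQ.1.1 hQP (fun h => ha0 (by
      have := hQ.1.2 (Ideal.mem_span_singleton_self a)
      rwa [h] at this)) (hind P hP)
    rwa [← this]
  have hinc : ∀ P ∈ S, ∀ Q ∈ S, P ≤ Q → P = Q := fun P hP Q hQ h =>
    inc_aux x hxinj ha P Q (hpr P hP) h (hS0 P hP) (hind Q hQ)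
  obtain ⟨f, hf, hδf⟩ := core (K := K) hfg x hxinj ha D _ hw0 hD δ hδ S hS hpr hDst hwP hp hfinS hinc
  have hf2 : pbF.br (algebraMap B K (x 2)) f = 0 := by
    have h : (algebraMap B K (pb.br (x 1) (x 2)))⁻¹ * -(pbF.br (algebraMap B K (x 2)) f) = 0 := hδf 0
    simpa [hwK] using h
  have hf1 : pbF.br (algebraMap B K (x 1)) f = 0 := by
    have h : (algebraMap B K (pb.br (x 1) (x 2)))⁻¹ * (pbF.br (algebraMap B K (x 1)) f) = 0 := hδf 1
    simpa [hwK] using h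
  let X : Fin 3 → K := fun i => algebraMap B K (x i)
  have hΘ : (pbF.br (X 1) (X 2)) • pbF.ham (X 0) - (pbF.br (X 0) (X 2)) • pbF.ham (X 1) + (pbF.br (X 0) (X 1)) • pbF.ham (X 2) = 0 := by
    apply vanish x hxinj ha
    intro i
    change pbF.br (X 1) (X 2) * pbF.br (X 0) (X i) - pbF.br (X 0) (X 2) * pbF.br (X 1) (X i) + pbF.br (X 0) (X 1) * pbF.br (X 2) (X i) = 0
    have e1 := pbF.antisymm (X 1) (X 0)
    have e2 := pbF.antisymm (X 2) (X 0)
    have e3 := pbF.antisymm (X 2) (X 1)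
    have e4 := pbF.br_self (X 0)
    have e5 := pbF.br_self (X 1)
    have e6 := pbF.br_self (X 2)
    fin_cases i
    · simp only [Fin.zero_eta, Fin.isValue]; rw [e1, e2, e4]; ring
    · simp only [Fin.mk_one, Fin.isValue]; rw [e3, e5]; ring
    · simp only [Fin.reduceFinMk, Fin.isValue]; rw [e6]; ring
  have hf0 : pbF.br (X 0) f = 0 := by
    have h := DFunLike.congr_fun hΘ f
    change pbF.br (X 1) (X 2) * pbF.br (X 0) f - pbF.br (X 0) (X 2) * pbF.br (X 1) f + pbF.br (X 0) (X 1) * pbF.br (X 2) f = 0 at h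
    have h1 : pbF.br (X 1) f = 0 := hf1
    have h2 : pbF.br (X 2) f = 0 := hf2
    have h3 : pbF.br (X 1) (X 2) ≠ 0 := by
      change pbF.br (algebraMap B K (x 1)) (algebraMap B K (x 2)) ≠ 0
      rwa [hc]
    rw [h1, h2] at h
    simpa [h3] using h
  have hff : pbF.ham f = 0 := by
    apply vanish x hxinj ha
    intro i
    change pbF.br f (X i) = 0
    rw [pbF.antisymm, neg_eq_zero]
    fin_cases i
    · exact hf0
    · exact hf1
    · exact hf2
  exact hf (hrat f (fun g => DFunLike.congr_fun hff g))

theorem dim_le_of_integral {R S : Type*} [CommRing R] [CommRing S] [IsDomain S] [Algebra R S] [Algebra.IsIntegral R S]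
    (hinj : Function.Injective (algebraMap R S)) : ringKrullDim R ≤ ringKrullDim S := by
  unfold ringKrullDim Order.krullDim
  apply iSup_le
  intro l
  obtain ⟨Q, -, hQ, hQ'⟩ := Ideal.exists_ideal_over_prime_of_isIntegral_of_isPrime (S := S) l.head.asIdeal (⊥ : Ideal S)
    (by rw [Ideal.comap_bot_of_injective _ hinj]; exact bot_le)
  haveI : Q.LiesOver (RelSeries.head l).asIdeal := ⟨hQ'.symm⟩
  obtain ⟨L, hL, -⟩ := Ideal.exists_ltSeries_of_hasGoingUp l Q
  rw [← hL]
  exact le_iSup (fun L : LTSeries (PrimeSpectrum S) => (L.length : WithBot ℕ∞)) L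

theorem exists_nonroot : ∀ (m : ℕ) (g : ℕ → MvPolynomial (Fin m) ℂ), (∀ n, g n ≠ 0) →
    ∃ a : Fin m → ℂ, ∀ n, MvPolynomial.eval a (g n) ≠ 0 := by
  intro m
  induction m with
  | zero =>
    intro g hg
    refine ⟨fun i => i.elim0, fun n h => hg n ?_⟩
    have h1 : g n = MvPolynomial.C (MvPolynomial.coeff 0 (g n)) := MvPolynomial.eq_C_of_isEmpty _
    rw [h1, MvPolynomial.eval_C] at h
    rw [h1, h, MvPolynomial.C_0]
  | succ m ih =>
    intro g hg
    obtain ⟨s, hs⟩ := ih (fun n => (MvPolynomial.finSuccEquiv ℂ m (g n)).leadingCoeff) (fun n => by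
      simpa using hg n)
    have hne : ∀ n, Polynomial.map (MvPolynomial.eval s) (MvPolynomial.finSuccEquiv ℂ m (g n)) ≠ 0 := by
      intro n h
      apply hs n
      have := congrArg (fun q => Polynomial.coeff q (MvPolynomial.finSuccEquiv ℂ m (g n)).natDegree) h
      simpa using this
    have hcount : (⋃ n, {y : ℂ | Polynomial.IsRoot (Polynomial.map (MvPolynomial.eval s) (MvPolynomial.finSuccEquiv ℂ m (g n))) y}).Countable :=
      Set.countable_iUnion (fun n => (Polynomial.finite_setOf_isRoot (hne n)).countable)
    have : ∃ y, y ∉ (⋃ n, {y : ℂ | Polynomial.IsRoot (Polynomial.map (MvPolynomial.eval s) (MvPolynomial.finSuccEquiv ℂ m (g n))) y}) := by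
      by_contra hcon
      push Not at hcon
      exact not_countable_complex ((Set.eq_univ_of_forall hcon) ▸ hcount)
    obtain ⟨y, hy⟩ := this
    refine ⟨Fin.cons y s, fun n h => hy ?_⟩
    rw [MvPolynomial.eval_eq_eval_mv_eval'] at h
    exact Set.mem_iUnion.2 ⟨n, h⟩

theorem reindex_aux {B σ τ : Type*} [CommRing B] [Algebra ℂ B] (u : σ → B) (y : τ → B)
    (Φ : MvPolynomial τ ℂ ≃ₐ[ℂ] MvPolynomial σ ℂ)
    (h : ∀ i, MvPolynomial.aeval u (Φ (MvPolynomial.X i)) = y i)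
    (hinj : Function.Injective (MvPolynomial.aeval u : MvPolynomial σ ℂ →ₐ[ℂ] B))
    (ha : (MvPolynomial.aeval u : MvPolynomial σ ℂ →ₐ[ℂ] B).toRingHom.IsIntegral) :
    (∀ q, MvPolynomial.aeval y q = MvPolynomial.aeval u (Φ q)) ∧
    Function.Injective (MvPolynomial.aeval y : MvPolynomial τ ℂ →ₐ[ℂ] B) ∧
    (MvPolynomial.aeval y : MvPolynomial τ ℂ →ₐ[ℂ] B).toRingHom.IsIntegral := by
  have he : (MvPolynomial.aeval y : MvPolynomial τ ℂ →ₐ[ℂ] B) = (MvPolynomial.aeval u).comp (Φ : MvPolynomial τ ℂ →ₐ[ℂ] MvPolynomial σ ℂ) := by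
    ext i; simp [h]
  have hq : ∀ q, MvPolynomial.aeval y q = MvPolynomial.aeval u (Φ q) := fun q => by rw [he]; rfl
  refine ⟨hq, ?_, ?_⟩
  · intro p q hpq
    rw [hq, hq] at hpq
    exact Φ.injective (hinj hpq)
  · rw [he]
    exact RingHom.IsIntegral.trans _ _ (RingHom.isIntegral_of_surjective _ Φ.surjective) ha

theorem coeff_line (q : R3) (N : ℕ) :
    (MvPolynomial.aeval (![Polynomial.X, 0, 0] : Fin 3 → Polynomial ℂ) q).coeff N = MvPolynomial.coeff (Finsupp.single 0 N) q := by
  classical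
  induction q using MvPolynomial.induction_on' with
  | add p q hp hq => simp [hp, hq]
  | monomial m c =>
    rw [MvPolynomial.aeval_monomial, Finsupp.prod_fintype _ _ (by simp), Fin.prod_univ_three, MvPolynomial.coeff_monomial]
    simp only [Matrix.cons_val]
    have key : m = Finsupp.single 0 N ↔ m 0 = N ∧ m 1 = 0 ∧ m 2 = 0 := by
      constructor
      · rintro rfl; simp
      · rintro ⟨h0, h1, h2⟩
        ext i
        fin_cases i
        · simpa using h0
        · simpa using h1
        · simpa using h2
    rw [show algebraMap ℂ (Polynomial ℂ) c = Polynomial.C c from rfl, Polynomial.coeff_C_mul]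
    by_cases h1 : m 1 = 0
    · by_cases h2 : m 2 = 0
      · simp only [key, h1, h2, pow_zero, mul_one, and_true, Polynomial.coeff_X_pow]
        by_cases h0 : m 0 = N
        · simp [h0]
        · simp [h0, Ne.symm h0]
      · simp [key, h2]
    · simp [key, h1]

theorem coeff_ray (p : R3) (t : Fin 3 → ℂ) (N : ℕ) :
    (MvPolynomial.aeval (fun i => Polynomial.C (t i) * Polynomial.X : Fin 3 → Polynomial ℂ) p).coeff N =
      MvPolynomial.eval t (MvPolynomial.homogeneousComponent N p) := by
  classical
  induction p using MvPolynomial.induction_on' with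
  | add p q hp hq => simp [hp, hq]
  | monomial m c =>
    rw [MvPolynomial.aeval_monomial, Finsupp.prod_fintype _ _ (by simp)]
    have h1 : ∏ i, (Polynomial.C (t i) * Polynomial.X) ^ m i = Polynomial.C (∏ i, t i ^ m i) * Polynomial.X ^ (m.degree) := by
      simp only [mul_pow, Finset.prod_mul_distrib, Finset.prod_pow_eq_pow_sum, Finsupp.degree_eq_sum, map_prod, map_pow]
    rw [h1, show algebraMap ℂ (Polynomial ℂ) c = Polynomial.C c from rfl, Polynomial.coeff_C_mul, Polynomial.coeff_C_mul, Polynomial.coeff_X_pow]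
    by_cases h : N = m.degree
    · have : MvPolynomial.homogeneousComponent N (MvPolynomial.monomial m c) = MvPolynomial.monomial m c :=
        MvPolynomial.homogeneousComponent_eq_self (MvPolynomial.isHomogeneous_monomial c h.symm)
      rw [this, MvPolynomial.eval_monomial, Finsupp.prod_fintype _ _ (by simp)]
      simp [h]
    · rw [MvPolynomial.homogeneousComponent_of_mem ((MvPolynomial.mem_homogeneousSubmodule _ _).2 (MvPolynomial.isHomogeneous_monomial c rfl))]
      simp [h]

theorem totalDegree_sub_le (p : R3) (z : Fin 3 → R3) (hz : ∀ i, (z i).totalDegree ≤ 1) :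
    (MvPolynomial.aeval z p).totalDegree ≤ p.totalDegree := by
  classical
  rw [MvPolynomial.aeval_def, MvPolynomial.eval₂_eq']
  apply MvPolynomial.totalDegree_finsetSum_le
  intro m hm
  refine (MvPolynomial.totalDegree_mul _ _).trans ?_
  rw [MvPolynomial.algebraMap_eq, MvPolynomial.totalDegree_C, zero_add]
  refine (MvPolynomial.totalDegree_finset_prod _ _).trans ?_
  have h1 := (MvPolynomial.le_totalDegree hm)
  have h2 : (m.sum fun _ e => e) = ∑ i, m i := Finsupp.sum_fintype _ _ (by simp)
  rw [h2] at h1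
  refine le_trans (Finset.sum_le_sum (fun i _ => ?_)) h1
  refine (MvPolynomial.totalDegree_pow _ _).trans ?_
  exact (Nat.mul_le_mul_left _ (hz i)).trans (by simp)

theorem case_zero {B K σ : Type*} [CommRing B] [IsDomain B] [Algebra ℂ B] [Field K] [Algebra ℂ K] [Algebra B K]
    [IsScalarTower ℂ B K] [IsFractionRing B K] [Fintype σ]
    (pb : PoissonBracket ℂ B) (pbF : PoissonBracket ℂ K)
    (hc : ∀ a b, pbF.br (algebraMap B K a) (algebraMap B K b) = algebraMap B K (pb.br a b))
    (hrat : ∀ f : K, (∀ g, pbF.br f g = 0) → IsAlgebraic ℂ f)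
    (x : σ → B) (hxinj : Function.Injective (MvPolynomial.aeval x : MvPolynomial σ ℂ →ₐ[ℂ] B))
    (ha : (MvPolynomial.aeval x : MvPolynomial σ ℂ →ₐ[ℂ] B).toRingHom.IsIntegral)
    (h0 : ∀ i j, pb.br (x i) (x j) = 0) (P : Ideal B) (hP : P.IsPrime) : P = ⊥ := by
  have h1 : ∀ i, pbF.ham (algebraMap B K (x i)) = 0 := by
    intro i
    apply vanish x hxinj ha
    intro j
    rw [PoissonBracket.ham_apply, hc, h0, map_zero]
  have h2 : ∀ f, pbF.ham f = 0 := by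
    intro f
    apply vanish x hxinj ha
    intro j
    rw [PoissonBracket.ham_apply, pbF.antisymm, ← PoissonBracket.ham_apply, h1]
    simp
  have h3 : ∀ b : B, IsAlgebraic ℂ b := fun b =>
    (isAlgebraic_algebraMap_iff (IsFractionRing.injective B K)).1 (hrat _ (fun g => DFunLike.congr_fun (h2 _) g))
  rw [eq_bot_iff]
  intro b hb
  by_contra hb0
  have h4 := Ideal.comap_ne_bot_of_algebraic_mem (I := P) hb0 hb (h3 b)
  rcases eq_bot_or_eq_top (P.comap (algebraMap ℂ B)) with h | h
  · exact h4 h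
  · apply hP.ne_top
    rw [Ideal.eq_top_iff_one] at h ⊢
    rw [Ideal.mem_comap, map_one] at h
    exact h

theorem exists_poly_mem {B σ : Type*} [CommRing B] [IsDomain B] [Algebra ℂ B] (x : σ → B)
    (ha : (MvPolynomial.aeval x : MvPolynomial σ ℂ →ₐ[ℂ] B).toRingHom.IsIntegral) (P : Ideal B) (hP : P ≠ ⊥) :
    ∃ r : MvPolynomial σ ℂ, r ≠ 0 ∧ MvPolynomial.aeval x r ∈ P := by
  letI : Algebra (MvPolynomial σ ℂ) B := (MvPolynomial.aeval x : MvPolynomial σ ℂ →ₐ[ℂ] B).toRingHom.toAlgebra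
  haveI : Algebra.IsIntegral (MvPolynomial σ ℂ) B := ⟨ha⟩
  by_contra hcon
  push Not at hcon
  apply hP
  apply Ideal.eq_bot_of_comap_eq_bot (R := MvPolynomial σ ℂ)
  rw [eq_bot_iff]
  intro p hp
  by_contra h
  exact hcon p h hp

theorem case_two {B : Type*} [CommRing B] [IsDomain B] [Algebra ℂ B]
    (pb : PoissonBracket ℂ B) (x : Fin 2 → B)
    (ha : (MvPolynomial.aeval x : MvPolynomial (Fin 2) ℂ →ₐ[ℂ] B).toRingHom.IsIntegral)
    (P : Ideal B) (hP : P.IsPrime) (hPP : pb.IsPoissonIdeal P) (hP0 : P ≠ ⊥) : pb.br (x 0) (x 1) ∈ P := by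
  by_contra hw
  obtain ⟨r, hr0, hr⟩ := exists_poly_mem x ha P hP0
  let D : Fin 2 → Derivation ℂ B B := ![-(pb.ham (x 1)), pb.ham (x 0)]
  have hD : ∀ j k : Fin 2, D j (x k) = if j = k then pb.br (x 0) (x 1) else 0 := by
    intro j k
    fin_cases j <;> fin_cases k <;> simp [D, PoissonBracket.ham_apply, pb.br_self]
    exact (pb.antisymm _ _).symm
  have hDst : ∀ j, ∀ a ∈ P, D j a ∈ P := by
    intro j a ha
    have h1 : ∀ b, pb.br b a ∈ P := fun b => by
      rw [pb.antisymm]; exact P.neg_mem (hPP a ha b)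
    fin_cases j
    · exact P.neg_mem (h1 (x 1))
    · exact h1 (x 0)
  exact hr0 (indep_mod_prime D x _ hD P hP hDst hw r hr)

theorem case_three {B K : Type*} [CommRing B] [IsDomain B] [Algebra ℂ B] [Field K] [Algebra ℂ K] [Algebra B K]
    [IsScalarTower ℂ B K] [IsFractionRing B K] (hfg : Algebra.FiniteType ℂ B)
    (pb : PoissonBracket ℂ B) (pbF : PoissonBracket ℂ K)
    (hc : ∀ a b, pbF.br (algebraMap B K a) (algebraMap B K b) = algebraMap B K (pb.br a b))
    (hrat : ∀ f : K, (∀ g, pbF.br f g = 0) → IsAlgebraic ℂ f)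
    (u : Fin 3 → B) (hxinj : Function.Injective (MvPolynomial.aeval u : R3 →ₐ[ℂ] B))
    (ha : (MvPolynomial.aeval u : R3 →ₐ[ℂ] B).toRingHom.IsIntegral)
    (hw0 : pb.br (u 1) (u 2) ≠ 0) :
    ∃ b : B, b ≠ 0 ∧ ∀ P : Ideal B, P.IsPrime → pb.IsPoissonIdeal P → P ≠ ⊥ → b ∈ P := by
  classical
  set w := pb.br (u 1) (u 2) with hw
  let S : Set (Ideal B) := {P | P.IsPrime ∧ pb.IsPoissonIdeal P ∧ P ≠ ⊥ ∧ w ∉ P}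
  by_cases hS : S.Finite
  · have h1 : ∀ P : Ideal B, ∃ a : B, a ≠ 0 ∧ (P ≠ ⊥ → a ∈ P) := by
      intro P
      by_cases h : P = ⊥
      · exact ⟨1, one_ne_zero, fun h' => absurd h h'⟩
      · obtain ⟨a, ha, ha0⟩ := Submodule.exists_mem_ne_zero_of_ne_bot h
        exact ⟨a, ha0, fun _ => ha⟩
    choose a ha0 haP using h1
    refine ⟨w * ∏ P ∈ hS.toFinset, a P, mul_ne_zero hw0 (Finset.prod_ne_zero_iff.2 (fun P _ => ha0 P)), ?_⟩
    intro P hP hPP hP0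
    by_cases hwP : w ∈ P
    · exact P.mul_mem_right _ hwP
    · apply P.mul_mem_left
      have : P ∈ hS.toFinset := hS.mem_toFinset.2 ⟨hP, hPP, hP0, hwP⟩
      rw [← Finset.mul_prod_erase _ _ this]
      exact P.mul_mem_right _ (haP P hP0)
  exfalso
  replace hS : S.Infinite := hS
  let e := hS.natEmbedding
  let Pn : ℕ → Ideal B := fun n => (e n).1
  have hPn : ∀ n, Pn n ∈ S := fun n => (e n).2
  have hp : ∀ n, ∃ r : R3, r ≠ 0 ∧ MvPolynomial.aeval u r ∈ Pn n := fun n => exists_poly_mem u ha _ (hPn n).2.2.1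
  choose p hp0 hpP using hp
  have hl : ∀ n, ∃ l : B →ₗ[ℂ] ℂ, l w ≠ 0 ∧ ∀ b ∈ Pn n, l b = 0 := by
    intro n
    obtain ⟨f, hf, hf'⟩ := Submodule.exists_le_ker_of_notMem (p := (Pn n).restrictScalars ℂ) (v := w) (hPn n).2.2.2
    exact ⟨f, hf, fun b hb => hf' hb⟩
  choose l hlw hlP using hl
  let lin : ℕ → R3 := fun n => MvPolynomial.C (l n w) * MvPolynomial.X 0 - MvPolynomial.C (l n (pb.br (u 0) (u 2))) * MvPolynomial.X 1
    - MvPolynomial.C (l n (pb.br (u 1) (u 0))) * MvPolynomial.X 2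
  have hlin : ∀ n, lin n ≠ 0 := by
    intro n h
    have := congrArg (MvPolynomial.eval (![1, 0, 0] : Fin 3 → ℂ)) h
    simp [lin] at this
    exact hlw n this
  have htop : ∀ n, MvPolynomial.homogeneousComponent (p n).totalDegree (p n) ≠ 0 := by
    intro n h
    obtain ⟨m, hm, hm'⟩ := Finset.exists_mem_eq_sup (p n).support (MvPolynomial.support_nonempty.2 (hp0 n)) (fun s => s.sum fun _ e => e)
    have h1 := congrArg (MvPolynomial.coeff m) h
    rw [MvPolynomial.coeff_homogeneousComponent, MvPolynomial.coeff_zero] at h1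
    have h2 : m.degree = (p n).totalDegree := hm'.symm
    rw [if_pos h2] at h1
    exact MvPolynomial.mem_support_iff.1 hm h1
  obtain ⟨t, ht⟩ := exists_nonroot 3 (fun n => MvPolynomial.X 0 * MvPolynomial.homogeneousComponent (p n).totalDegree (p n) * lin n)
    (fun n => mul_ne_zero (mul_ne_zero (MvPolynomial.X_ne_zero _) (htop n)) (hlin n))
  simp only [map_mul, mul_ne_zero_iff, MvPolynomial.eval_X] at ht
  have ht0 := (ht 0).1.1
  let Φ : R3 →ₐ[ℂ] R3 := MvPolynomial.aeval ![MvPolynomial.C (t 0)⁻¹ * MvPolynomial.X 0,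
    MvPolynomial.X 1 - MvPolynomial.C (t 1 / t 0) * MvPolynomial.X 0, MvPolynomial.X 2 - MvPolynomial.C (t 2 / t 0) * MvPolynomial.X 0]
  let zΨ : Fin 3 → R3 := ![MvPolynomial.C (t 0) * MvPolynomial.X 0,
    MvPolynomial.X 1 + MvPolynomial.C (t 1) * MvPolynomial.X 0, MvPolynomial.X 2 + MvPolynomial.C (t 2) * MvPolynomial.X 0]
  let Ψ : R3 →ₐ[ℂ] R3 := MvPolynomial.aeval zΨ
  have hC1 : (MvPolynomial.C (t 0) : R3) * MvPolynomial.C (t 0)⁻¹ = 1 := by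
    rw [← MvPolynomial.C_mul, mul_inv_cancel₀ ht0, MvPolynomial.C_1]
  have hΦΨ : Φ.comp Ψ = AlgHom.id ℂ R3 := by
    ext1 i
    fin_cases i
    · simp [Φ, Ψ, zΨ, MvPolynomial.algHom_C, MvPolynomial.algebraMap_eq]
      linear_combination MvPolynomial.X 0 * hC1
    · simp [Φ, Ψ, zΨ, MvPolynomial.algHom_C, MvPolynomial.algebraMap_eq, div_eq_mul_inv]
      ring
    · simp [Φ, Ψ, zΨ, MvPolynomial.algHom_C, MvPolynomial.algebraMap_eq, div_eq_mul_inv]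
      ring
  have hΨΦ : Ψ.comp Φ = AlgHom.id ℂ R3 := by
    ext1 i
    fin_cases i
    · simp [Φ, Ψ, zΨ, MvPolynomial.algHom_C, MvPolynomial.algebraMap_eq]
      linear_combination MvPolynomial.X 0 * hC1
    · simp [Φ, Ψ, zΨ, MvPolynomial.algHom_C, MvPolynomial.algebraMap_eq, div_eq_mul_inv]
      linear_combination - MvPolynomial.C (t 1) * MvPolynomial.X 0 * hC1
    · simp [Φ, Ψ, zΨ, MvPolynomial.algHom_C, MvPolynomial.algebraMap_eq, div_eq_mul_inv]
      linear_combination - MvPolynomial.C (t 2) * MvPolynomial.X 0 * hC1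
  let y : Fin 3 → B := ![(t 0)⁻¹ • u 0, u 1 - (t 1 / t 0) • u 0, u 2 - (t 2 / t 0) • u 0]
  obtain ⟨hyq, hyinj, hyint⟩ := reindex_aux u y (AlgEquiv.ofAlgHom Φ Ψ hΦΨ hΨΦ) (by
    intro i
    fin_cases i <;> simp [Φ, y, Algebra.smul_def]) hxinj ha
  have hfin := good_finite hfg pb pbF hc hrat y hyinj hyint (Set.range Pn)
    (by rintro _ ⟨n, rfl⟩; exact (hPn n).1) (by rintro _ ⟨n, rfl⟩; exact (hPn n).2.2.1)
    (by rintro _ ⟨n, rfl⟩; exact (hPn n).2.1)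
    (by
      rintro _ ⟨n, rfl⟩ hmem
      apply (ht n).2
      have h1 := hlP n _ hmem
      have h2 : pb.br (y 1) (y 2) = w - (t 1 / t 0) • pb.br (u 0) (u 2) - (t 2 / t 0) • pb.br (u 1) (u 0) := by
        simp [y, pb.br_self, hw]
        abel
      rw [h2] at h1
      simp only [map_sub, map_smul, smul_eq_mul] at h1
      simp only [lin, map_sub, map_mul, MvPolynomial.eval_C, MvPolynomial.eval_X]
      field_simp at h1
      linear_combination h1)
    (by
      rintro _ ⟨n, rfl⟩
      refine ⟨Ψ (p n), (p n).totalDegree, ?_, ?_, ?_⟩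
      · apply totalDegree_sub_le
        have hcx : ∀ c : ℂ, (MvPolynomial.C c * MvPolynomial.X 0 : R3).totalDegree ≤ 1 := by
          intro c
          refine (MvPolynomial.totalDegree_mul _ _).trans ?_
          simp
        intro i
        fin_cases i
        · exact hcx _
        · refine (MvPolynomial.totalDegree_add _ _).trans (max_le ?_ (hcx _))
          simp
        · refine (MvPolynomial.totalDegree_add _ _).trans (max_le ?_ (hcx _))
          simp
      · rw [← coeff_line]
        have h1 : (MvPolynomial.aeval (![Polynomial.X, 0, 0] : Fin 3 → Polynomial ℂ)).comp Ψ =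
            MvPolynomial.aeval (fun i => Polynomial.C (t i) * Polynomial.X : Fin 3 → Polynomial ℂ) := by
          ext1 i
          fin_cases i <;> simp [Ψ, zΨ, Polynomial.C_eq_algebraMap]
        have h2 := DFunLike.congr_fun h1 (p n)
        rw [AlgHom.comp_apply] at h2
        rw [h2, coeff_ray]
        exact (ht n).1.2
      · rw [hyq]
        have : (AlgEquiv.ofAlgHom Φ Ψ hΦΨ hΨΦ) (Ψ (p n)) = p n := DFunLike.congr_fun hΦΨ (p n)
        rw [this]
        exact hpP n)
  refine Set.infinite_range_of_injective ?_ hfin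
  intro a b hab
  exact e.injective (Subtype.ext hab)

theorem quot_poisson {A : Type*} [CommRing A] [Algebra ℂ A] (pb : PoissonBracket ℂ A) (P : Ideal A)
    (hP : pb.IsPoissonIdeal P) : ∃ pq : PoissonBracket ℂ (A ⧸ P), ∀ a b, pq.br (Ideal.Quotient.mk P a) (Ideal.Quotient.mk P b) =
      Ideal.Quotient.mk P (pb.br a b) := by
  have hP' : ∀ a, ∀ b ∈ P, pb.br a b ∈ P := fun a b hb => by
    rw [pb.antisymm]; exact P.neg_mem (hP b hb a)
  let s : A ⧸ P → A := Function.surjInv Ideal.Quotient.mk_surjective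
  have hs : ∀ b, Ideal.Quotient.mk P (s b) = b := Function.surjInv_eq Ideal.Quotient.mk_surjective
  let f : A ⧸ P → A ⧸ P → A ⧸ P := fun a b => Ideal.Quotient.mk P (pb.br (s a) (s b))
  have hf : ∀ a b, f (Ideal.Quotient.mk P a) (Ideal.Quotient.mk P b) = Ideal.Quotient.mk P (pb.br a b) := by
    intro a b
    have h1 : ∀ a, s (Ideal.Quotient.mk P a) - a ∈ P := fun a => by
      rw [← Ideal.Quotient.eq_zero_iff_mem, map_sub, hs, sub_self]
    apply Ideal.Quotient.eq.2
    have : pb.br (s (Ideal.Quotient.mk P a)) (s (Ideal.Quotient.mk P b)) - pb.br a b =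
      pb.br (s (Ideal.Quotient.mk P a) - a) (s (Ideal.Quotient.mk P b)) + pb.br a (s (Ideal.Quotient.mk P b) - b) := by
      simp only [map_sub, LinearMap.sub_apply]; abel
    rw [this]
    exact P.add_mem (hP _ (h1 a) _) (hP' _ _ (h1 b))
  have hsm : ∀ (c : ℂ) a, c • Ideal.Quotient.mk P a = Ideal.Quotient.mk P (c • a) := fun c a => rfl
  let br : (A ⧸ P) →ₗ[ℂ] (A ⧸ P) →ₗ[ℂ] (A ⧸ P) := LinearMap.mk₂ ℂ f
    (by
      intro a a' b
      obtain ⟨a, rfl⟩ := Ideal.Quotient.mk_surjective a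
      obtain ⟨a', rfl⟩ := Ideal.Quotient.mk_surjective a'
      obtain ⟨b, rfl⟩ := Ideal.Quotient.mk_surjective b
      rw [← map_add, hf, hf, hf, pb.br.map_add, LinearMap.add_apply, map_add])
    (by
      intro c a b
      obtain ⟨a, rfl⟩ := Ideal.Quotient.mk_surjective a
      obtain ⟨b, rfl⟩ := Ideal.Quotient.mk_surjective b
      rw [hsm, hf, hf, hsm, pb.br.map_smul, LinearMap.smul_apply])
    (by
      intro b a a'
      obtain ⟨a, rfl⟩ := Ideal.Quotient.mk_surjective a
      obtain ⟨a', rfl⟩ := Ideal.Quotient.mk_surjective a'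
      obtain ⟨b, rfl⟩ := Ideal.Quotient.mk_surjective b
      rw [← map_add, hf, hf, hf, (pb.br b).map_add, map_add])
    (by
      intro c a b
      obtain ⟨a, rfl⟩ := Ideal.Quotient.mk_surjective a
      obtain ⟨b, rfl⟩ := Ideal.Quotient.mk_surjective b
      rw [hsm, hf, hf, hsm, (pb.br a).map_smul])
  have hbr : ∀ a b, br (Ideal.Quotient.mk P a) (Ideal.Quotient.mk P b) = Ideal.Quotient.mk P (pb.br a b) := hf
  refine ⟨⟨br, ?_, ?_, ?_⟩, hbr⟩
  · intro a b
    obtain ⟨a, rfl⟩ := Ideal.Quotient.mk_surjective a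
    obtain ⟨b, rfl⟩ := Ideal.Quotient.mk_surjective b
    rw [hbr, hbr, pb.antisymm, map_neg]
  · intro a b c
    obtain ⟨a, rfl⟩ := Ideal.Quotient.mk_surjective a
    obtain ⟨b, rfl⟩ := Ideal.Quotient.mk_surjective b
    obtain ⟨c, rfl⟩ := Ideal.Quotient.mk_surjective c
    simp only [hbr]
    rw [← map_add, ← map_add, pb.jacobi, map_zero]
  · intro a b c
    obtain ⟨a, rfl⟩ := Ideal.Quotient.mk_surjective a
    obtain ⟨b, rfl⟩ := Ideal.Quotient.mk_surjective b
    obtain ⟨c, rfl⟩ := Ideal.Quotient.mk_surjective c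
    simp only [← map_mul, hbr]
    rw [← map_add, pb.leibniz]

theorem perm_aux {B : Type*} [CommRing B] [Algebra ℂ B] {n : ℕ} (u : Fin n → B) (e : Equiv.Perm (Fin n))
    (hinj : Function.Injective (MvPolynomial.aeval u : MvPolynomial (Fin n) ℂ →ₐ[ℂ] B))
    (ha : (MvPolynomial.aeval u : MvPolynomial (Fin n) ℂ →ₐ[ℂ] B).toRingHom.IsIntegral) :
    Function.Injective (MvPolynomial.aeval (u ∘ e) : MvPolynomial (Fin n) ℂ →ₐ[ℂ] B) ∧
    (MvPolynomial.aeval (u ∘ e) : MvPolynomial (Fin n) ℂ →ₐ[ℂ] B).toRingHom.IsIntegral :=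
  (reindex_aux u (u ∘ e) (MvPolynomial.renameEquiv ℂ e) (by intro i; simp) hinj ha).2

theorem exists_bad {B K : Type*} [CommRing B] [IsDomain B] [Algebra ℂ B] [Field K] [Algebra ℂ K] [Algebra B K]
    [IsScalarTower ℂ B K] [IsFractionRing B K] (hfg : Algebra.FiniteType ℂ B) (hdim : ringKrullDim B ≤ 3)
    (pb : PoissonBracket ℂ B) (pbF : PoissonBracket ℂ K)
    (hc : ∀ a b, pbF.br (algebraMap B K a) (algebraMap B K b) = algebraMap B K (pb.br a b))
    (hrat : ∀ f : K, (∀ g, pbF.br f g = 0) → IsAlgebraic ℂ f) :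
    ∃ b : B, b ≠ 0 ∧ ∀ P : Ideal B, P.IsPrime → pb.IsPoissonIdeal P → P ≠ ⊥ → b ∈ P := by
  classical
  obtain ⟨n, g, hginj, hgint⟩ := exists_integral_inj_algHom_of_fg ℂ B
  have hg : g = MvPolynomial.aeval (fun i => g (MvPolynomial.X i)) := by ext i; simp
  obtain ⟨u, rfl⟩ : ∃ u : Fin n → B, g = MvPolynomial.aeval u := ⟨_, hg⟩
  have hn : n ≤ 3 := by
    letI : Algebra (MvPolynomial (Fin n) ℂ) B := (MvPolynomial.aeval u : MvPolynomial (Fin n) ℂ →ₐ[ℂ] B).toRingHom.toAlgebra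
    haveI : Algebra.IsIntegral (MvPolynomial (Fin n) ℂ) B := ⟨hgint⟩
    have h1 := (dim_le_of_integral (R := MvPolynomial (Fin n) ℂ) (S := B) hginj).trans hdim
    rw [MvPolynomial.ringKrullDim_of_isNoetherianRing, ringKrullDim_eq_zero_of_field, zero_add] at h1
    have h2 : Nat.card (Fin n) ≤ 3 := by exact_mod_cast h1
    simpa using h2
  by_cases h0 : ∀ i j, pb.br (u i) (u j) = 0
  · refine ⟨1, one_ne_zero, fun P hP _ hP0 => ?_⟩
    exact absurd (case_zero pb pbF hc hrat u hginj hgint h0 P hP) hP0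
  push Not at h0
  obtain ⟨i, j, hij⟩ := h0
  have hne : i ≠ j := by rintro rfl; exact hij (pb.br_self _)
  interval_cases n
  · exact i.elim0
  · exact absurd (Subsingleton.elim i j) hne
  · obtain ⟨e, he0, he1⟩ : ∃ e : Equiv.Perm (Fin 2), e 0 = i ∧ e 1 = j := by
      clear hij; revert i j; decide
    have h := perm_aux u e hginj hgint
    refine ⟨pb.br (u i) (u j), hij, fun P hP hPP hP0 => ?_⟩
    have := case_two pb (u ∘ e) h.2 P hP hPP hP0
    simpa [he0, he1] using this
  · obtain ⟨e, he0, he1⟩ : ∃ e : Equiv.Perm (Fin 3), e 1 = i ∧ e 2 = j := by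
      clear hij; revert i j; decide
    have h := perm_aux u e hginj hgint
    exact case_three hfg pb pbF hc hrat (u ∘ e) h.1 h.2 (by simpa [he0, he1] using hij)

theorem PoissonBracket.lc_of_rat {A : Type*} [CommRing A] [IsDomain A] [Algebra ℂ A] (hfg : Algebra.FiniteType ℂ A)
    (pb : PoissonBracket ℂ A) (hdim : ringKrullDim A ≤ 3) (P : Ideal A) (hP : P.IsPrime) (hPP : pb.IsPoissonIdeal P)
    (h : pb.IsPoissonRational P) : pb.IsPoissonLocallyClosed P := by
  obtain ⟨pq, hpq⟩ := quot_poisson pb P hPP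
  obtain ⟨pbF, hF⟩ := poisson_ext_frac (F := FractionRing (A ⧸ P)) pq
  have hfg' : Algebra.FiniteType ℂ (A ⧸ P) := hfg.of_surjective (Ideal.Quotient.mkₐ ℂ P) Ideal.Quotient.mk_surjective
  have hdim' : ringKrullDim (A ⧸ P) ≤ 3 := (ringKrullDim_le_of_surjective (Ideal.Quotient.mk P) Ideal.Quotient.mk_surjective).trans hdim
  obtain ⟨b, hb0, hb⟩ := exists_bad hfg' hdim' pq pbF hF (h pbF (fun a b => by rw [hF, hpq]))
  obtain ⟨a, rfl⟩ := Ideal.Quotient.mk_surjective b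
  refine lt_of_le_of_ne (le_sInf (fun Q hQ => hQ.2.2.le)) (fun heq => ?_)
  apply hb0
  rw [Ideal.Quotient.eq_zero_iff_mem, heq, Ideal.mem_sInf]
  rintro Q ⟨hQ, hQP, hlt⟩
  have hmem : ∀ c, Ideal.Quotient.mk P c ∈ Q.map (Ideal.Quotient.mk P) ↔ c ∈ Q := by
    intro c
    rw [← Ideal.mem_comap, Ideal.comap_map_mk hlt.le]
  rw [← hmem]
  apply hb
  · exact Ideal.map_isPrime_of_surjective Ideal.Quotient.mk_surjective (by rw [Ideal.mk_ker]; exact hlt.le)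
  · intro c hc d
    obtain ⟨c, rfl⟩ := Ideal.Quotient.mk_surjective c
    obtain ⟨d, rfl⟩ := Ideal.Quotient.mk_surjective d
    rw [hpq, hmem]
    exact hQP c ((hmem c).1 hc) d
  · intro hbot
    apply hlt.not_ge
    intro c hc
    have := (hmem c).2 hc
    rw [hbot, Ideal.mem_bot] at this
    exact Ideal.Quotient.eq_zero_iff_mem.1 this

/-- Let `A` be a complex affine Poisson algebra of Krull dimension at
most `3`.  Then the Poisson Dixmier-Moeglin equivalence holds for `A`: for every Poisson
prime ideal `P`, `P` is Poisson locally closed iff `P` is Poisson primitive iff `P` is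
Poisson rational. -/
theorem poisson_dixmier_moeglin_of_krullDim_le_three
    (A : Type*) [CommRing A] [IsDomain A] [Algebra ℂ A]
    (hfg : Algebra.FiniteType ℂ A) (pb : PoissonBracket ℂ A)
    (hdim : ringKrullDim A ≤ 3) :
    ∀ P : Ideal A, P.IsPrime → pb.IsPoissonIdeal P →
      (pb.IsPoissonLocallyClosed P ↔ pb.IsPoissonPrimitive P) ∧
      (pb.IsPoissonPrimitive P ↔ pb.IsPoissonRational P) := by
  intro P hP hPP
  have h1 : pb.IsPoissonLocallyClosed P → pb.IsPoissonPrimitive P := fun h => pb.prim_of_lc hfg P hP hPP h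
  have h2 : pb.IsPoissonPrimitive P → pb.IsPoissonRational P := fun h => pb.rat_of_prim hfg P hP h
  have h3 : pb.IsPoissonRational P → pb.IsPoissonLocallyClosed P := fun h => pb.lc_of_rat hfg hdim P hP hPP h
  exact ⟨⟨h1, fun h => h3 (h2 h)⟩, ⟨h2, fun h => h1 (h3 h)⟩⟩
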